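/- arXiv:1904.12495 — 7 statements merged into one kernel-verified Lean document; each statement's English description precedes it below -/
import Mathlib

section
/- Fix r_0 > 0, v_∞ ∈ ℝ and k ∈ ℤ. For k ≠ 0 let w_k : (r_0, ∞) → ℂ be continuous with √s·w_k(s) ∈ L¹(r_0, ∞), and define v_r(r) = sign(k)·(i·r^{−|k|−1}/2)·∫_{r_0}^r s^{|k|+1}·w_k(s) ds + sign(k)·(i·r^{|k|−1}/2)·∫_r^∞ s^{−|k|+1}·w_k(s) ds + δ_{|k|,1}·v_∞/2 and v_φ(r) = (r^{−|k|−1}/2)·∫_{r_0}^r s^{|k|+1}·w_k(s) ds − (r^{|k|−1}/2)·∫_r^∞ s^{−|k|+1}·w_k(s) ds − sign(k)·δ_{|k|,1}·v_∞/(2i); for k = 0 let w_0 be continuous with s·w_0(s) ∈ L¹(r_0, ∞) and define v_r(r) = 0, v_φ(r) = (1/r)·∫_{r_0}^r s·w_0(s) ds. Then (v_r, v_φ) is differentiable on (r_0, ∞), solves the k-th Fourier-mode div–curl system with datum w_k, and satisfies v_r(r) → δ_{|k|,1}·v_∞/2 and v_φ(r) → −sign(k)·δ_{|k|,1}·v_∞/(2i)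 as r → ∞. -/
open Complex Set Filter MeasureTheory

/-- The `k`-th Fourier-mode div–curl system in polar coordinates on `(r₀, ∞)`. -/
def DivCurlSystem (r₀ : ℝ) (k : ℤ) (vr vφ w : ℝ → ℂ) : Prop :=
  ∀ r : ℝ, r₀ < r →
    (1 / (r : ℂ)) * deriv (fun ρ : ℝ => (ρ : ℂ) * vr ρ) r + (Complex.I * k / r) * vφ r = 0 ∧
    (1 / (r : ℂ)) * deriv (fun ρ : ℝ => (ρ : ℂ) * vφ ρ) r - (Complex.I * k / r) * vr r = w r

/-- Kronecker delta `δ_{|k|,1}`. -/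
noncomputable def deltaAbs1 (k : ℤ) : ℂ := if k.natAbs = 1 then 1 else 0

/-- The radial velocity component given by the Biot–Savart formula (mode `k ≠ 0`),
which also yields `0` when `k = 0`. -/
noncomputable def vrBS (r₀ : ℝ) (vinf : ℝ) (k : ℤ) (w : ℝ → ℂ) (r : ℝ) : ℂ :=
  (Int.sign k : ℂ) * (Complex.I * (r : ℂ) ^ (-(k.natAbs : ℤ) - 1) / 2) *
      (∫ s in r₀..r, (s : ℂ) ^ ((k.natAbs : ℤ) + 1) * w s)
    + (Int.sign k : ℂ) * (Complex.I * (r : ℂ) ^ ((k.natAbs : ℤ) - 1) / 2) *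
      (∫ s in Set.Ioi r, (s : ℂ) ^ (-(k.natAbs : ℤ) + 1) * w s)
    + deltaAbs1 k * vinf / 2

/-- The angular velocity component given by the Biot–Savart formula (mode `k ≠ 0`). -/
noncomputable def vφBS (r₀ : ℝ) (vinf : ℝ) (k : ℤ) (w : ℝ → ℂ) (r : ℝ) : ℂ :=
  ((r : ℂ) ^ (-(k.natAbs : ℤ) - 1) / 2) *
      (∫ s in r₀..r, (s : ℂ) ^ ((k.natAbs : ℤ) + 1) * w s)
    - ((r : ℂ) ^ ((k.natAbs : ℤ) - 1) / 2) *
      (∫ s in Set.Ioi r, (s : ℂ) ^ (-(k.natAbs : ℤ) + 1) * w s)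
    - (Int.sign k : ℂ) * deltaAbs1 k * vinf / (2 * Complex.I)

/-- The angular velocity component in the mode `k = 0`. -/
noncomputable def vφBS0 (r₀ : ℝ) (w : ℝ → ℂ) (r : ℝ) : ℂ :=
  (1 / (r : ℂ)) * ∫ s in r₀..r, (s : ℂ) * w s

lemma bs_bound (r₀ : ℝ) (S : Set ℝ) (hS : MeasurableSet S) (hSr : S ⊆ Set.Ioi r₀)
    (g f : ℝ → ℂ) (hg : ContinuousOn g (Set.Ioi r₀)) (hf : IntegrableOn f (Set.Ioi r₀))
    (C : ℝ) (hC : 0 ≤ C) (h : ∀ s ∈ S, ‖g s‖ ≤ C * ‖f s‖) :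
    IntegrableOn g S ∧ ‖∫ s in S, g s‖ ≤ C * ∫ s in Set.Ioi r₀, ‖f s‖ := by
  have hfS : IntegrableOn f S := hf.mono_set hSr
  have h1 : IntegrableOn (fun s => C * ‖f s‖) S := hfS.norm.const_mul C
  have h2 : ∀ᵐ s ∂(volume.restrict S), ‖g s‖ ≤ C * ‖f s‖ :=
    (ae_restrict_iff' hS).2 (Eventually.of_forall h)
  have hgS : IntegrableOn g S :=
    Integrable.mono' h1 ((hg.mono hSr).aestronglyMeasurable hS) h2
  refine ⟨hgS, ?_⟩
  calc ‖∫ s in S, g s‖ ≤ ∫ s in S, C * ‖f s‖ := norm_integral_le_of_norm_le h1 h2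
    _ = C * ∫ s in S, ‖f s‖ := integral_const_mul _ _
    _ ≤ C * ∫ s in Set.Ioi r₀, ‖f s‖ := by
      gcongr
      · exact Eventually.of_forall fun s => norm_nonneg _
      · exact hf.norm

lemma bs_deriv_left (r₀ : ℝ) (g : ℝ → ℂ) (hg : ContinuousOn g (Set.Ioi r₀)) (r : ℝ) (hr : r₀ < r)
    (hi : IntegrableOn g (Set.Ioc r₀ r)) :
    HasDerivAt (fun ρ : ℝ => ∫ s in r₀..ρ, g s) (g r) r := by
  apply intervalIntegral.integral_hasDerivAt_right
  · exact (intervalIntegrable_iff_integrableOn_Ioc_of_le hr.le).2 hi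
  · exact hg.stronglyMeasurableAtFilter isOpen_Ioi r hr
  · exact hg.continuousAt (Ioi_mem_nhds hr)

lemma bs_deriv_right (r₀ : ℝ) (g : ℝ → ℂ) (hg : ContinuousOn g (Set.Ioi r₀)) (r : ℝ) (hr : r₀ < r)
    (hi : IntegrableOn g (Set.Ioi r₀)) :
    HasDerivAt (fun ρ : ℝ => ∫ s in Set.Ioi ρ, g s) (-g r) r := by
  have h := (bs_deriv_left r₀ g hg r hr (hi.mono_set Ioc_subset_Ioi_self)).const_sub
    (∫ s in Set.Ioi r₀, g s)
  refine h.congr_of_eventuallyEq ?_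
  filter_upwards [Ioi_mem_nhds hr] with ρ hρ
  rw [← intervalIntegral.integral_Ioi_sub_Ioi hi (le_of_lt hρ)]
  ring

lemma bs_zpow_deriv (m : ℤ) (r : ℝ) (hr : r ≠ 0) :
    HasDerivAt (fun ρ : ℝ => (ρ : ℂ) ^ m) (m * (r : ℂ) ^ (m - 1)) r :=
  (hasDerivAt_zpow m (r : ℂ) (Or.inl (by exact_mod_cast hr))).comp_ofReal

lemma bs_cont (r₀ : ℝ) (hr₀ : 0 < r₀) (m : ℤ) (w : ℝ → ℂ) (hw : ContinuousOn w (Set.Ioi r₀)) :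
    ContinuousOn (fun s : ℝ => (s : ℂ) ^ m * w s) (Set.Ioi r₀) := by
  refine ContinuousOn.mul (fun s hs => ?_) hw
  have : s ≠ 0 := (hr₀.trans hs).ne'
  exact (bs_zpow_deriv m s this).continuousAt.continuousWithinAt

lemma bs_left (r₀ : ℝ) (hr₀ : 0 < r₀) (n : ℕ) (w : ℝ → ℂ) (hw : ContinuousOn w (Set.Ioi r₀))
    (hf : IntegrableOn (fun s : ℝ => (Real.sqrt s : ℂ) * w s) (Set.Ioi r₀)) (r : ℝ) :
    IntegrableOn (fun s : ℝ => (s : ℂ) ^ ((n : ℤ) + 1) * w s) (Set.Ioc r₀ r) ∧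
    ‖∫ s in Set.Ioc r₀ r, (s : ℂ) ^ ((n : ℤ) + 1) * w s‖ ≤
      (|r| ^ n * √r) * ∫ s in Set.Ioi r₀, ‖(Real.sqrt s : ℂ) * w s‖ := by
  apply bs_bound r₀ _ measurableSet_Ioc Ioc_subset_Ioi_self _ _ (bs_cont r₀ hr₀ _ w hw) hf
  · positivity
  rintro s ⟨hs, hsr⟩
  have s0 : 0 < s := hr₀.trans hs
  have r0 : 0 < r := s0.trans_le hsr
  have e : (s : ℂ) ^ ((n : ℤ) + 1) = ((s ^ n * (√s * √s) : ℝ) : ℂ) := by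
    rw [Real.mul_self_sqrt s0.le, ← pow_succ]; push_cast; exact_mod_cast rfl
  rw [norm_mul, norm_mul, e, Complex.norm_real, Complex.norm_real, Real.norm_of_nonneg (by positivity),
    Real.norm_of_nonneg (by positivity), abs_of_pos r0]
  calc s ^ n * (√s * √s) * ‖w s‖ = s ^ n * √s * (√s * ‖w s‖) := by ring
    _ ≤ _ := by gcongr

lemma bs_right (r₀ : ℝ) (hr₀ : 0 < r₀) (n : ℕ) (w : ℝ → ℂ) (hw : ContinuousOn w (Set.Ioi r₀))
    (hf : IntegrableOn (fun s : ℝ => (Real.sqrt s : ℂ) * w s) (Set.Ioi r₀)) (r : ℝ) (hr : r₀ ≤ r) :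
    IntegrableOn (fun s : ℝ => (s : ℂ) ^ (-((n + 1 : ℕ) : ℤ) + 1) * w s) (Set.Ioi r) ∧
    ‖∫ s in Set.Ioi r, (s : ℂ) ^ (-((n + 1 : ℕ) : ℤ) + 1) * w s‖ ≤
      ((r ^ n * √r)⁻¹) * ∫ s in Set.Ioi r₀, ‖(Real.sqrt s : ℂ) * w s‖ := by
  have r0 : 0 < r := hr₀.trans_le hr
  apply bs_bound r₀ _ measurableSet_Ioi (Ioi_subset_Ioi hr) _ _ (bs_cont r₀ hr₀ _ w hw) hf
  · positivity
  intro s hs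
  have hs : r < s := hs
  have s0 : 0 < s := r0.trans hs
  have e : (s : ℂ) ^ (-((n + 1 : ℕ) : ℤ) + 1) = (((s ^ n * √s)⁻¹ * √s : ℝ) : ℂ) := by
    have : (s ^ n * √s)⁻¹ * √s = (s ^ n)⁻¹ := by
      have : √s ≠ 0 := by positivity
      field_simp
    rw [this, show (-((n + 1 : ℕ) : ℤ) + 1) = -(n : ℤ) by push_cast; ring, zpow_neg, zpow_natCast]
    push_cast; rfl
  rw [norm_mul, norm_mul, e, Complex.norm_real, Complex.norm_real, Real.norm_of_nonneg (by positivity),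
    Real.norm_of_nonneg (by positivity), mul_assoc]
  gcongr

/-- decay of the two basic pieces -/
lemma bs_lim_left (r₀ : ℝ) (hr₀ : 0 < r₀) (n : ℕ) (w : ℝ → ℂ) (hw : ContinuousOn w (Set.Ioi r₀))
    (hf : IntegrableOn (fun s : ℝ => (Real.sqrt s : ℂ) * w s) (Set.Ioi r₀)) :
    Tendsto (fun r : ℝ => (r : ℂ) ^ (-(n : ℤ) - 1) * ∫ s in r₀..r, (s : ℂ) ^ ((n : ℤ) + 1) * w s)
      atTop (nhds 0) := by
  have hl : Tendsto (fun r : ℝ => (√r)⁻¹ * ∫ s in Set.Ioi r₀, ‖(Real.sqrt s : ℂ) * w s‖) atTop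
      (nhds 0) := by
    simpa using (Real.tendsto_sqrt_atTop.inv_tendsto_atTop).mul_const
      (∫ s in Set.Ioi r₀, ‖(Real.sqrt s : ℂ) * w s‖)
  refine squeeze_zero_norm' ?_ hl
  filter_upwards [eventually_gt_atTop r₀] with r hr
  have r0 : 0 < r := hr₀.trans hr
  have q : √r * √r = r := Real.mul_self_sqrt r0.le
  have q0 : 0 < √r := by positivity
  rw [intervalIntegral.integral_of_le hr.le, norm_mul, norm_zpow, Complex.norm_real,
    Real.norm_of_nonneg r0.le]
  have h := (bs_left r₀ hr₀ n w hw hf r).2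
  rw [abs_of_pos r0] at h
  calc _ ≤ r ^ (-(n : ℤ) - 1) * ((r ^ n * √r) * ∫ s in Set.Ioi r₀, ‖(Real.sqrt s : ℂ) * w s‖) := by
        gcongr
    _ = _ := by
        rw [← mul_assoc]
        congr 1
        rw [show -(n : ℤ) - 1 = -((n + 1 : ℕ) : ℤ) by push_cast; ring, zpow_neg, zpow_natCast, pow_succ]
        field_simp
        nlinarith

lemma bs_lim_right (r₀ : ℝ) (hr₀ : 0 < r₀) (n : ℕ) (w : ℝ → ℂ) (hw : ContinuousOn w (Set.Ioi r₀))
    (hf : IntegrableOn (fun s : ℝ => (Real.sqrt s : ℂ) * w s) (Set.Ioi r₀)) :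
    Tendsto (fun r : ℝ => (r : ℂ) ^ (((n + 1 : ℕ) : ℤ) - 1) *
      ∫ s in Set.Ioi r, (s : ℂ) ^ (-((n + 1 : ℕ) : ℤ) + 1) * w s) atTop (nhds 0) := by
  have hl : Tendsto (fun r : ℝ => (√r)⁻¹ * ∫ s in Set.Ioi r₀, ‖(Real.sqrt s : ℂ) * w s‖) atTop
      (nhds 0) := by
    simpa using (Real.tendsto_sqrt_atTop.inv_tendsto_atTop).mul_const
      (∫ s in Set.Ioi r₀, ‖(Real.sqrt s : ℂ) * w s‖)
  refine squeeze_zero_norm' ?_ hl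
  filter_upwards [eventually_gt_atTop r₀] with r hr
  have r0 : 0 < r := hr₀.trans hr
  have q0 : 0 < √r := by positivity
  rw [norm_mul, norm_zpow, Complex.norm_real, Real.norm_of_nonneg r0.le]
  have h := (bs_right r₀ hr₀ n w hw hf r hr.le).2
  calc _ ≤ r ^ (((n + 1 : ℕ) : ℤ) - 1) *
          ((r ^ n * √r)⁻¹ * ∫ s in Set.Ioi r₀, ‖(Real.sqrt s : ℂ) * w s‖) := by
        gcongr
    _ = _ := by
        rw [← mul_assoc]
        congr 1
        rw [show (((n + 1 : ℕ) : ℤ) - 1) = (n : ℤ) by push_cast; ring, zpow_natCast]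
        field_simp

lemma bs_zero (r₀ : ℝ) (hr₀ : 0 < r₀) (w : ℝ → ℂ) (hw : ContinuousOn w (Set.Ioi r₀))
    (hf : IntegrableOn (fun s : ℝ => (s : ℂ) * w s) (Set.Ioi r₀)) :
    (∀ r, r₀ < r → HasDerivAt (fun ρ : ℝ => ∫ s in r₀..ρ, (s : ℂ) * w s) ((r : ℂ) * w r) r) ∧
    Tendsto (vφBS0 r₀ w) atTop (nhds 0) := by
  have hc : ContinuousOn (fun s : ℝ => (s : ℂ) * w s) (Set.Ioi r₀) :=
    Complex.continuous_ofReal.continuousOn.mul hw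
  refine ⟨fun r hr => bs_deriv_left r₀ _ hc r hr (hf.mono_set Ioc_subset_Ioi_self), ?_⟩
  have h1 := intervalIntegral_tendsto_integral_Ioi r₀ hf tendsto_id
  have h2 : Tendsto (fun r : ℝ => (1 / (r : ℂ))) atTop (nhds 0) := by
    have := (Complex.continuous_ofReal.tendsto 0).comp tendsto_inv_atTop_zero
    simpa [Function.comp_def] using this
  have h3 := h2.mul h1
  rw [zero_mul] at h3
  exact h3

theorem biotSavart_solves_divcurl (r₀ : ℝ) (hr₀ : 0 < r₀) (vinf : ℝ) (k : ℤ)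
    (w : ℝ → ℂ) (hw : ContinuousOn w (Set.Ioi r₀))
    (hL1 : k ≠ 0 → IntegrableOn (fun s : ℝ => (Real.sqrt s : ℂ) * w s) (Set.Ioi r₀))
    (hL10 : k = 0 → IntegrableOn (fun s : ℝ => (s : ℂ) * w s) (Set.Ioi r₀))
    (vr vφ : ℝ → ℂ)
    (hvr : ∀ r : ℝ, r₀ < r → vr r = if k = 0 then 0 else vrBS r₀ vinf k w r)
    (hvφ : ∀ r : ℝ, r₀ < r → vφ r = if k = 0 then vφBS0 r₀ w r else vφBS r₀ vinf k w r) :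
    (∀ r : ℝ, r₀ < r → DifferentiableAt ℝ vr r ∧ DifferentiableAt ℝ vφ r) ∧
    DivCurlSystem r₀ k vr vφ w ∧
    Tendsto vr atTop (nhds (deltaAbs1 k * vinf / 2)) ∧
    Tendsto vφ atTop (nhds (-(Int.sign k : ℂ) * deltaAbs1 k * vinf / (2 * Complex.I))) := by
  by_cases hk : k = 0
  · subst hk
    obtain ⟨hd, hl⟩ := bs_zero r₀ hr₀ w hw (hL10 rfl)
    simp only [if_true] at hvr hvφ
    have er : ∀ r, r₀ < r → vr =ᶠ[nhds r] fun _ => 0 := fun r hr => by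
      filter_upwards [Ioi_mem_nhds hr] with ρ hρ using hvr ρ hρ
    have eφ : ∀ r, r₀ < r → vφ =ᶠ[nhds r] vφBS0 r₀ w := fun r hr => by
      filter_upwards [Ioi_mem_nhds hr] with ρ hρ using hvφ ρ hρ
    refine ⟨fun r hr => ⟨?_, ?_⟩, fun r hr => ⟨?_, ?_⟩, ?_, ?_⟩
    · exact (differentiableAt_const (0 : ℂ)).congr_of_eventuallyEq (er r hr)
    · refine DifferentiableAt.congr_of_eventuallyEq ?_ (eφ r hr)
      have r0 : r ≠ 0 := (hr₀.trans hr).ne'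
      have h := (bs_zpow_deriv (-1) r r0).mul (hd r hr)
      refine h.differentiableAt.congr_of_eventuallyEq (Eventually.of_forall fun ρ => ?_)
      simp [vφBS0]
    · have : (fun ρ : ℝ => (ρ : ℂ) * vr ρ) =ᶠ[nhds r] fun _ => 0 := by
        filter_upwards [er r hr] with ρ hρ
        simp [hρ]
      rw [this.deriv_eq]; simp
    · have : (fun ρ : ℝ => (ρ : ℂ) * vφ ρ) =ᶠ[nhds r] fun ρ : ℝ => ∫ s in r₀..ρ, (s : ℂ) * w s := by
        filter_upwards [eφ r hr, Ioi_mem_nhds hr] with ρ hρ hρ'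
        have : (ρ : ℂ) ≠ 0 := by exact_mod_cast (hr₀.trans hρ').ne'
        rw [hρ, vφBS0]; field_simp
      have r0 : (r : ℂ) ≠ 0 := by exact_mod_cast (hr₀.trans hr).ne'
      rw [this.deriv_eq, (hd r hr).deriv]; simp; field_simp
    · simp only [deltaAbs1]
      refine (tendsto_congr' ?_).2 (by simpa using tendsto_const_nhds)
      filter_upwards [eventually_gt_atTop r₀] with ρ hρ using hvr ρ hρ
    · simp only [Int.sign_zero, Int.cast_zero, neg_zero, zero_mul, zero_div]
      refine (tendsto_congr' ?_).2 hl
      filter_upwards [eventually_gt_atTop r₀] with ρ hρ using hvφ ρ hρ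
  · simp only [hk, if_false] at hvr hvφ
    have hf := hL1 hk
    obtain ⟨n, hn⟩ : ∃ n, k.natAbs = n + 1 :=
      Nat.exists_eq_succ_of_ne_zero (Int.natAbs_ne_zero.2 hk)
    have hkn : (k : ℂ) = (Int.sign k : ℂ) * ((n : ℂ) + 1) := by
      have := Int.sign_mul_natAbs k
      rw [hn] at this
      exact_mod_cast this.symm
    have hss : (Int.sign k : ℂ) * (Int.sign k : ℂ) = 1 := by
      rcases lt_or_gt_of_ne hk with h | h
      · simp [Int.sign_eq_neg_one_of_neg h]
      · simp [Int.sign_eq_one_of_pos h]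
    have hδ : deltaAbs1 k * (n : ℂ) = 0 := by
      simp only [deltaAbs1, hn]
      split_ifs with h
      · have : n = 0 := by omega
        simp [this]
      · simp
    have lA := bs_lim_left r₀ hr₀ (n + 1) w hw hf
    have lB := bs_lim_right r₀ hr₀ n w hw hf
    have dA : ∀ r, r₀ < r → _ := fun r hr =>
      bs_deriv_left r₀ _ (bs_cont r₀ hr₀ (((n + 1 : ℕ) : ℤ) + 1) w hw) r hr
        (bs_left r₀ hr₀ (n + 1) w hw hf r).1
    have dB : ∀ r, r₀ < r → _ := fun r hr =>
      bs_deriv_right r₀ _ (bs_cont r₀ hr₀ (-((n + 1 : ℕ) : ℤ) + 1) w hw) r hr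
        (bs_right r₀ hr₀ n w hw hf r₀ le_rfl).1
    unfold vrBS at hvr
    unfold vφBS at hvφ
    rw [hn] at hvr hvφ
    generalize (Int.sign k : ℂ) = σ at *
    generalize deltaAbs1 k = δ at *
    set A : ℝ → ℂ := fun r => ∫ s in r₀..r, (s : ℂ) ^ (((n + 1 : ℕ) : ℤ) + 1) * w s with hA
    set B : ℝ → ℂ := fun r => ∫ s in Set.Ioi r, (s : ℂ) ^ (-((n + 1 : ℕ) : ℤ) + 1) * w s with hB
    have da : ∀ r, r₀ < r → HasDerivAt (fun ρ : ℝ => (ρ : ℂ) ^ (-((n + 1 : ℕ) : ℤ) - 1) * A ρ)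
        (-((n : ℂ) + 2) * (r : ℂ) ^ (-((n + 1 : ℕ) : ℤ) - 1) * A r / r + w r) r := by
      intro r hr
      have r0 : r ≠ 0 := (hr₀.trans hr).ne'
      have r0' : (r : ℂ) ≠ 0 := by exact_mod_cast r0
      refine HasDerivAt.congr_deriv ((bs_zpow_deriv (-((n + 1 : ℕ) : ℤ) - 1) r r0).mul (dA r hr)) ?_
      rw [zpow_sub_one₀ r0' (-((n + 1 : ℕ) : ℤ) - 1),
        ← mul_assoc ((r : ℂ) ^ (-((n + 1 : ℕ) : ℤ) - 1)) _ (w r), ← zpow_add₀ r0']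
      rw [show (-((n + 1 : ℕ) : ℤ) - 1) + (((n + 1 : ℕ) : ℤ) + 1) = 0 by ring, zpow_zero]
      push_cast
      ring
    have db : ∀ r, r₀ < r → HasDerivAt (fun ρ : ℝ => (ρ : ℂ) ^ (((n + 1 : ℕ) : ℤ) - 1) * B ρ)
        ((n : ℂ) * (r : ℂ) ^ (((n + 1 : ℕ) : ℤ) - 1) * B r / r - w r) r := by
      intro r hr
      have r0 : r ≠ 0 := (hr₀.trans hr).ne'
      have r0' : (r : ℂ) ≠ 0 := by exact_mod_cast r0
      refine HasDerivAt.congr_deriv ((bs_zpow_deriv (((n + 1 : ℕ) : ℤ) - 1) r r0).mul (dB r hr)) ?_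
      rw [zpow_sub_one₀ r0' (((n + 1 : ℕ) : ℤ) - 1), mul_neg, ← mul_assoc ((r : ℂ) ^ (((n + 1 : ℕ) : ℤ) - 1)),
        ← zpow_add₀ r0']
      rw [show (((n + 1 : ℕ) : ℤ) - 1) + (-((n + 1 : ℕ) : ℤ) + 1) = 0 by ring, zpow_zero]
      push_cast
      ring
    set a : ℝ → ℂ := fun ρ : ℝ => (ρ : ℂ) ^ (-((n + 1 : ℕ) : ℤ) - 1) * A ρ with ha
    set b : ℝ → ℂ := fun ρ : ℝ => (ρ : ℂ) ^ (((n + 1 : ℕ) : ℤ) - 1) * B ρ with hb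
    have hvr' : ∀ r, r₀ < r → vr r = σ * I / 2 * (a r + b r) + δ * vinf / 2 := by
      intro r hr
      rw [hvr r hr]; simp only [ha, hb, hA, hB]; ring
    have hvφ' : ∀ r, r₀ < r → vφ r = 1 / 2 * (a r - b r) + -σ * δ * vinf / (2 * I) := by
      intro r hr
      rw [hvφ r hr]; simp only [ha, hb, hA, hB]; ring
    have da' : ∀ r, r₀ < r → HasDerivAt a (-((n : ℂ) + 2) * a r / r + w r) r := by
      intro r hr
      convert da r hr using 1
      simp only [ha]; ring
    have db' : ∀ r, r₀ < r → HasDerivAt b ((n : ℂ) * b r / r - w r) r := by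
      intro r hr
      convert db r hr using 1
      simp only [hb]; ring
    have la : Tendsto a atTop (nhds 0) := lA
    have lb : Tendsto b atTop (nhds 0) := lB
    clear_value a b
    have Dr : ∀ r, r₀ < r → HasDerivAt vr
        (σ * I / 2 * ((-((n : ℂ) + 2) * a r / r + w r) + ((n : ℂ) * b r / r - w r))) r := by
      intro r hr
      refine HasDerivAt.congr_of_eventuallyEq
        ((((da' r hr).add (db' r hr)).const_mul (σ * I / 2)).add_const (δ * vinf / 2)) ?_
      filter_upwards [Ioi_mem_nhds hr] with ρ hρ using hvr' ρ hρ
    have Dφ : ∀ r, r₀ < r → HasDerivAt vφ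
        (1 / 2 * ((-((n : ℂ) + 2) * a r / r + w r) - ((n : ℂ) * b r / r - w r))) r := by
      intro r hr
      refine HasDerivAt.congr_of_eventuallyEq
        ((((da' r hr).sub (db' r hr)).const_mul (1 / 2 : ℂ)).add_const (-σ * δ * vinf / (2 * I))) ?_
      filter_upwards [Ioi_mem_nhds hr] with ρ hρ using hvφ' ρ hρ
    have hid : ∀ r : ℝ, HasDerivAt (fun ρ : ℝ => (ρ : ℂ)) 1 r := fun r =>
      (hasDerivAt_id (r : ℂ)).comp_ofReal
    have hI : -σ * δ * vinf / (2 * I) = I * σ * δ * vinf / 2 := by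
      have := Complex.I_ne_zero
      field_simp
      rw [Complex.I_sq]
      ring
    refine ⟨fun r hr => ⟨(Dr r hr).differentiableAt, (Dφ r hr).differentiableAt⟩,
      fun r hr => ⟨?_, ?_⟩, ?_, ?_⟩
    · have r0 : (r : ℂ) ≠ 0 := by exact_mod_cast (hr₀.trans hr).ne'
      have e : deriv (fun ρ : ℝ => (ρ : ℂ) * vr ρ) r = _ := ((hid r).mul (Dr r hr)).deriv
      rw [e, hvr' r hr, hvφ' r hr, hkn, hI]
      field_simp
      linear_combination (δ * vinf * (n + 1) * σ * σ) * Complex.I_sq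
        - δ * vinf * (n + 1) * hss - vinf * hδ
    · have r0 : (r : ℂ) ≠ 0 := by exact_mod_cast (hr₀.trans hr).ne'
      have e : deriv (fun ρ : ℝ => (ρ : ℂ) * vφ ρ) r = _ := ((hid r).mul (Dφ r hr)).deriv
      rw [e, hvr' r hr, hvφ' r hr, hkn, hI]
      field_simp
      linear_combination (-(n + 1) * σ * σ * (a r + b r)) * Complex.I_sq
        + (n + 1) * (a r + b r) * hss - I * σ * vinf * hδ
    · have := ((la.add lb).const_mul (σ * I / 2)).add_const (δ * vinf / 2)
      simp only [add_zero, mul_zero, zero_add] at this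
      refine (tendsto_congr' ?_).2 this
      filter_upwards [eventually_gt_atTop r₀] with ρ hρ using hvr' ρ hρ
    · have := ((la.sub lb).const_mul (1 / 2 : ℂ)).add_const (-σ * δ * vinf / (2 * I))
      simp only [sub_zero, mul_zero, zero_add] at this
      refine (tendsto_congr' ?_).2 this
      filter_upwards [eventually_gt_atTop r₀] with ρ hρ using hvφ' ρ hρ
end

section
/- Fix r_0 > 0, v_∞ ∈ ℝ and k ∈ ℤ, k ≠ 0, and let w_k : (r_0, ∞) → ℂ be continuous with √s·w_k(s) ∈ L¹(r_0, ∞). For α ∈ ℂ define v_r^α(r) = sign(k)·(i·r^{−|k|−1}/2)·∫_{r_0}^r s^{|k|+1}·w_k(s) ds + sign(k)·(i·r^{|k|−1}/2)·∫_r^∞ s^{−|k|+1}·w_k(s) ds + δ_{|k|,1}·v_∞/2 + α·i·r^{−|k|−1} and v_φ^α(r) = (r^{−|k|−1}/2)·∫_{r_0}^r s^{|k|+1}·w_k(s) ds − (r^{|k|−1}/2)·∫_r^∞ s^{−|k|+1}·w_k(s) ds − sign(k)·δ_{|k|,1}·v_∞/(2i) + sign(k)·α·r^{−|k|−1}. If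 v_r^α(r_0) = 0 and v_φ^α(r_0) = 0, then α = 0 and ∫_{r_0}^∞ s^{−|k|+1}·w_k(s) ds = i·v_∞·δ_{|k|,1}·sign(k)/r_0^{|k|−1}. Moreover, for k = 0, if w_0 is continuous with s·w_0(s) ∈ L¹(r_0, ∞) and the pair v_r(r) = α/r, v_φ(r) = (1/r)·∫_{r_0}^r s·w_0(s) ds + θ/r (α, θ ∈ ℂ) vanishes at r = r_0, then α = 0 and θ = 0. -/
open Complex Set Filter MeasureTheory

/-- The radial velocity component with free parameter `α` (mode `k ≠ 0`). -/
noncomputable def vrBSα (r₀ : ℝ) (vinf : ℝ) (k : ℤ) (w : ℝ → ℂ) (α : ℂ) (r : ℝ) : ℂ :=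
  (Int.sign k : ℂ) * (Complex.I * (r : ℂ) ^ (-(k.natAbs : ℤ) - 1) / 2) *
      (∫ s in r₀..r, (s : ℂ) ^ ((k.natAbs : ℤ) + 1) * w s)
    + (Int.sign k : ℂ) * (Complex.I * (r : ℂ) ^ ((k.natAbs : ℤ) - 1) / 2) *
      (∫ s in Set.Ioi r, (s : ℂ) ^ (-(k.natAbs : ℤ) + 1) * w s)
    + deltaAbs1 k * vinf / 2
    + α * Complex.I * (r : ℂ) ^ (-(k.natAbs : ℤ) - 1)

/-- The angular velocity component with free parameter `α` (mode `k ≠ 0`). -/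
noncomputable def vφBSα (r₀ : ℝ) (vinf : ℝ) (k : ℤ) (w : ℝ → ℂ) (α : ℂ) (r : ℝ) : ℂ :=
  ((r : ℂ) ^ (-(k.natAbs : ℤ) - 1) / 2) *
      (∫ s in r₀..r, (s : ℂ) ^ ((k.natAbs : ℤ) + 1) * w s)
    - ((r : ℂ) ^ ((k.natAbs : ℤ) - 1) / 2) *
      (∫ s in Set.Ioi r, (s : ℂ) ^ (-(k.natAbs : ℤ) + 1) * w s)
    - (Int.sign k : ℂ) * deltaAbs1 k * vinf / (2 * Complex.I)
    + (Int.sign k : ℂ) * α * (r : ℂ) ^ (-(k.natAbs : ℤ) - 1)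

theorem noslip_forces_alpha_zero (r₀ : ℝ) (hr₀ : 0 < r₀) (vinf : ℝ) (k : ℤ) (hk : k ≠ 0)
    (w : ℝ → ℂ) (hw : ContinuousOn w (Set.Ioi r₀))
    (hL1 : IntegrableOn (fun s : ℝ => (Real.sqrt s : ℂ) * w s) (Set.Ioi r₀))
    (α : ℂ)
    (w0 : ℝ → ℂ) (hw0 : ContinuousOn w0 (Set.Ioi r₀))
    (hL10 : IntegrableOn (fun s : ℝ => (s : ℂ) * w0 s) (Set.Ioi r₀))
    (α0 θ : ℂ) :
    (vrBSα r₀ vinf k w α r₀ = 0 ∧ vφBSα r₀ vinf k w α r₀ = 0 →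
      α = 0 ∧
      (∫ s in Set.Ioi r₀, (s : ℂ) ^ (-(k.natAbs : ℤ) + 1) * w s)
        = Complex.I * vinf * deltaAbs1 k * (Int.sign k : ℂ) / (r₀ : ℂ) ^ ((k.natAbs : ℤ) - 1)) ∧
    ((α0 / (r₀ : ℂ) = 0 ∧
        (1 / (r₀ : ℂ)) * (∫ s in r₀..r₀, (s : ℂ) * w0 s) + θ / (r₀ : ℂ) = 0) →
      α0 = 0 ∧ θ = 0) := by
  have hr : (r₀ : ℂ) ≠ 0 := by exact_mod_cast hr₀.ne'
  refine ⟨?_, ?_⟩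
  · rintro ⟨h1, h2⟩
    unfold vrBSα at h1
    unfold vφBSα at h2
    rw [intervalIntegral.integral_same] at h1 h2
    have hA : (r₀ : ℂ) ^ (-(k.natAbs : ℤ) - 1) ≠ 0 := zpow_ne_zero _ hr
    have hB : (r₀ : ℂ) ^ ((k.natAbs : ℤ) - 1) ≠ 0 := zpow_ne_zero _ hr
    have hs : (Int.sign k : ℂ) * (Int.sign k : ℂ) = 1 := by
      rcases lt_or_gt_of_ne hk with h | h
      · simp [Int.sign_eq_neg_one_of_neg h]
      · simp [Int.sign_eq_one_of_pos h]
    have hI : Complex.I * Complex.I = -1 := Complex.I_mul_I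
    have hdiv : (Int.sign k : ℂ) * deltaAbs1 k * vinf / (2 * Complex.I)
        = -Complex.I * ((Int.sign k : ℂ) * deltaAbs1 k * vinf) / 2 := by
      rw [div_eq_div_iff (by simp) (by simp)]
      linear_combination (2 * (Int.sign k : ℂ) * deltaAbs1 k * vinf) * hI
    rw [hdiv] at h2
    generalize (∫ s in Set.Ioi r₀, (s : ℂ) ^ (-(k.natAbs : ℤ) + 1) * w s) = J at *
    generalize (r₀ : ℂ) ^ (-(k.natAbs : ℤ) - 1) = A at *
    generalize (r₀ : ℂ) ^ ((k.natAbs : ℤ) - 1) = B at *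
    generalize (Int.sign k : ℂ) = σ at *
    generalize deltaAbs1 k = d at *
    have hα : α * A = 0 := by
      linear_combination (-Complex.I / 2) * h1 + (σ / 2) * h2
        + (σ * B * J / 4 + α * A / 2) * hI - (Complex.I * d * vinf / 4 + α * A / 2) * hs
    have hα0 : α = 0 := (mul_eq_zero.mp hα).resolve_right hA
    refine ⟨hα0, ?_⟩
    subst hα0
    rw [eq_div_iff hB]
    linear_combination (-2) * h2
  · rintro ⟨h1, h2⟩
    rw [intervalIntegral.integral_same] at h2
    simp [hr] at h1 h2
    exact ⟨h1, h2⟩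
end

section
/- (Slip boundary condition.) Fix r_0 > 0, v_∞ ∈ ℝ and k ∈ ℤ, k ≠ 0, and let w_k : (r_0, ∞) → ℂ be continuous with √s·w_k(s) ∈ L¹(r_0, ∞). For α ∈ ℂ define v_r^α and v_φ^α by v_r^α(r) = sign(k)·(i·r^{−|k|−1}/2)·∫_{r_0}^r s^{|k|+1}·w_k(s) ds + sign(k)·(i·r^{|k|−1}/2)·∫_r^∞ s^{−|k|+1}·w_k(s) ds + δ_{|k|,1}·v_∞/2 + α·i·r^{−|k|−1} and v_φ^α(r) = (r^{−|k|−1}/2)·∫_{r_0}^r s^{|k|+1}·w_k(s) ds − (r^{|k|−1}/2)·∫_r^∞ s^{−|k|+1}·w_k(s) ds − sign(k)·δ_{|k|,1}·v_∞/(2i) + sign(k)·α·r^{−|k|−1}. Then v_r^α(r_0) = 0 if and only if α = −(sign(k)·r_0^{2|k|}/2)·∫_{r_0}^∞ s^{−|k|+1}·w_k(s) ds + (i/2)·r_0^{|k|+1}·δ_{|k|,1}·v_∞. Moreover, in the mode k = 0, for every θ ∈ ℂ the pair v_r(r) = 0, v_φ(r) = (1/r)·∫_{r_0}^r s·w_0(s)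 ds + θ/r solves the 0-th Fourier-mode div–curl system with datum a continuous w_0 satisfying s·w_0(s) ∈ L¹(r_0, ∞), together with v_r(r_0) = 0; hence the slip condition does not determine the solution uniquely. -/
open Complex Set Filter MeasureTheory

theorem slip_condition (r₀ : ℝ) (hr₀ : 0 < r₀) (vinf : ℝ) (k : ℤ) (hk : k ≠ 0)
    (w : ℝ → ℂ) (hw : ContinuousOn w (Set.Ioi r₀))
    (hL1 : IntegrableOn (fun s : ℝ => (Real.sqrt s : ℂ) * w s) (Set.Ioi r₀))
    (w0 : ℝ → ℂ) (hw0 : ContinuousOn w0 (Set.Ioi r₀))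
    (hL10 : IntegrableOn (fun s : ℝ => (s : ℂ) * w0 s) (Set.Ioi r₀)) :
    (∀ α : ℂ, vrBSα r₀ vinf k w α r₀ = 0 ↔
      α = -((Int.sign k : ℂ) * (r₀ : ℂ) ^ (2 * (k.natAbs : ℤ)) / 2) *
            (∫ s in Set.Ioi r₀, (s : ℂ) ^ (-(k.natAbs : ℤ) + 1) * w s)
          + (Complex.I / 2) * (r₀ : ℂ) ^ ((k.natAbs : ℤ) + 1) * deltaAbs1 k * vinf) ∧
    (∀ θ : ℂ,
      DivCurlSystem r₀ 0 (fun _ => 0)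
        (fun r => (1 / (r : ℂ)) * (∫ s in r₀..r, (s : ℂ) * w0 s) + θ / (r : ℂ)) w0 ∧
      (fun _ : ℝ => (0 : ℂ)) r₀ = 0) := by
  have hR : (r₀ : ℂ) ≠ 0 := by exact_mod_cast hr₀.ne'
  refine ⟨?_, ?_⟩
  · intro α
    unfold vrBSα
    rw [intervalIntegral.integral_same]
    generalize (∫ s in Set.Ioi r₀, (s : ℂ) ^ (-(k.natAbs : ℤ) + 1) * w s) = J
    have e1 : (r₀ : ℂ) ^ ((k.natAbs : ℤ) - 1)
        = (r₀ : ℂ) ^ (2 * (k.natAbs : ℤ)) * (r₀ : ℂ) ^ (-(k.natAbs : ℤ) - 1) := by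
      rw [← zpow_add₀ hR]; congr 1; ring
    have e2 : (r₀ : ℂ) ^ ((k.natAbs : ℤ) + 1) * (r₀ : ℂ) ^ (-(k.natAbs : ℤ) - 1) = 1 := by
      rw [← zpow_add₀ hR]
      have : (k.natAbs : ℤ) + 1 + (-(k.natAbs : ℤ) - 1) = 0 := by ring
      rw [this, zpow_zero]
    rw [e1]
    generalize (r₀ : ℂ) ^ (2 * (k.natAbs : ℤ)) = B at *
    generalize (r₀ : ℂ) ^ ((k.natAbs : ℤ) + 1) = C at *
    generalize (r₀ : ℂ) ^ (-(k.natAbs : ℤ) - 1) = A at *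
    generalize (Int.sign k : ℂ) = σ
    generalize deltaAbs1 k = d
    have hI : Complex.I * Complex.I = -1 := Complex.I_mul_I
    constructor
    · intro h
      linear_combination (-Complex.I * C) * h + (α + σ * B * J / 2) * (Complex.I * Complex.I) * e2
        + (α + σ * B * J / 2) * hI
    · intro h
      rw [h]
      linear_combination (d * vinf / 2) * Complex.I * Complex.I * e2 + (d * vinf / 2) * hI
  · intro θ
    refine ⟨?_, rfl⟩
    intro r hr
    have hrpos : 0 < r := hr₀.trans hr
    have hrne : (r : ℂ) ≠ 0 := by exact_mod_cast hrpos.ne'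
    refine ⟨by simp, ?_⟩
    have hcont : ContinuousOn (fun s : ℝ => (s : ℂ) * w0 s) (Set.Ioi r₀) :=
      Complex.continuous_ofReal.continuousOn.mul hw0
    have hint : IntervalIntegrable (fun s : ℝ => (s : ℂ) * w0 s) volume r₀ r := by
      rw [intervalIntegrable_iff_integrableOn_Ioc_of_le hr.le]
      exact hL10.mono_set Set.Ioc_subset_Ioi_self
    have hd : HasDerivAt (fun ρ : ℝ => (∫ s in r₀..ρ, (s : ℂ) * w0 s) + θ) ((r : ℂ) * w0 r) r := by
      refine HasDerivAt.add_const θ ?_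
      exact intervalIntegral.integral_hasDerivAt_right hint
        (hcont.stronglyMeasurableAtFilter isOpen_Ioi r hr)
        (hcont.continuousAt (isOpen_Ioi.mem_nhds hr))
    have heq : (fun ρ : ℝ => (ρ : ℂ) * ((1 / (ρ : ℂ)) * (∫ s in r₀..ρ, (s : ℂ) * w0 s)
        + θ / (ρ : ℂ))) =ᶠ[nhds r] (fun ρ : ℝ => (∫ s in r₀..ρ, (s : ℂ) * w0 s) + θ) := by
      filter_upwards [isOpen_Ioi.mem_nhds (show r ∈ Set.Ioi (0 : ℝ) from hrpos)] with ρ hρ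
      have : (ρ : ℂ) ≠ 0 := by exact_mod_cast (ne_of_gt hρ)
      field_simp
    rw [heq.deriv_eq, hd.deriv]
    simp
    field_simp
end

section
/- Fix r_0 > 0, τ > 0 and an integer k ≥ 0. Let f : [r_0, ∞) → ℂ be continuous with √s·f(s) ∈ L¹(r_0, ∞), and let f_k(r) = K_k(√τ·r)·∫_{r_0}^r f(s)·I_k(√τ·s)·s ds + I_k(√τ·r)·∫_r^∞ f(s)·K_k(√τ·s)·s ds. Then the boundary operator Z_{k,r_0}[u] = r_0·u'(r_0) + k·u(r_0) applied to f_k satisfies r_0·f_k'(r_0) + k·f_k(r_0) = r_0·√τ·I_{k−1}(√τ·r_0)·∫_{r_0}^∞ f(s)·K_k(√τ·s)·s ds. -/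
open Complex Set Filter MeasureTheory

/-- Modified Bessel function of the first kind `I_k`. -/
noncomputable def besselI (k : ℕ) (x : ℝ) : ℝ :=
  ∑' m : ℕ, (x / 2) ^ (2 * m + k) / (Nat.factorial m * Nat.factorial (m + k))

/-- Modified Bessel function of the second kind `K_k`. -/
noncomputable def besselK (k : ℕ) (x : ℝ) : ℝ :=
  ∫ t in Set.Ioi (0 : ℝ), Real.exp (-x * Real.cosh t) * Real.cosh (k * t)

/-- `I_{k−1}`, with the convention `I_{−1} = I_1`. -/
noncomputable def besselIm1 (k : ℕ) : ℝ → ℝ :=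
  if k = 0 then besselI 1 else besselI (k - 1)

/-- The particular solution `f_k` of the inhomogeneous modified Bessel equation. -/
noncomputable def particularSol (r₀ τ : ℝ) (k : ℕ) (f : ℝ → ℂ) (r : ℝ) : ℂ :=
  (besselK k (Real.sqrt τ * r) : ℂ) *
      (∫ s in r₀..r, f s * (besselI k (Real.sqrt τ * s) : ℂ) * (s : ℂ))
    + (besselI k (Real.sqrt τ * r) : ℂ) *
      (∫ s in Set.Ioi r, f s * (besselK k (Real.sqrt τ * s) : ℂ) * (s : ℂ))

lemma besselI_aux_summable (k : ℕ) (x : ℝ) :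
    Summable (fun m : ℕ => (x / 2) ^ (2 * m + k) / ((Nat.factorial m : ℝ) * Nat.factorial (m + k))) := by
  have h := (Real.summable_pow_div_factorial (|x / 2| ^ 2)).mul_left (|x / 2| ^ k)
  refine Summable.of_norm_bounded h (fun m => ?_)
  rw [norm_div, norm_mul, norm_pow, Real.norm_eq_abs, RCLike.norm_natCast, RCLike.norm_natCast,
    pow_add, pow_mul, mul_comm (_ ^ m), mul_div_assoc]
  gcongr
  have h1 : (1 : ℝ) ≤ Nat.factorial (m + k) := by exact_mod_cast Nat.factorial_pos _
  have h2 : (0 : ℝ) < Nat.factorial m := by positivity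
  nlinarith

lemma besselI_hasDerivAt_aux (k : ℕ) (x : ℝ) :
    HasDerivAt (besselI k)
      (∑' m : ℕ, ((2 * m + k : ℕ) : ℝ) * (x / 2) ^ (2 * m + k - 1) * (1 / 2)
        / ((Nat.factorial m : ℝ) * Nat.factorial (m + k))) x ∧
    Summable (fun m : ℕ => ((2 * m + k : ℕ) : ℝ) * (x / 2) ^ (2 * m + k - 1) * (1 / 2)
        / ((Nat.factorial m : ℝ) * Nat.factorial (m + k))) := by
  set R : ℝ := |x| + 1 with hR
  have hR1 : 1 ≤ R := by have := abs_nonneg x; linarith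
  have hu : Summable (fun m : ℕ => R ^ k * ((R ^ 2) ^ m / (Nat.factorial m : ℝ))) :=
    (Real.summable_pow_div_factorial (R ^ 2)).mul_left _
  have hx : x ∈ Metric.ball (0 : ℝ) R := by simp [hR]
  have hb : ∀ (m : ℕ) (y : ℝ), y ∈ Metric.ball (0 : ℝ) R →
      ‖((2 * m + k : ℕ) : ℝ) * (y / 2) ^ (2 * m + k - 1) * (1 / 2)
        / ((Nat.factorial m : ℝ) * Nat.factorial (m + k))‖ ≤
      R ^ k * ((R ^ 2) ^ m / (Nat.factorial m : ℝ)) := by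
    intro m y hy
    have hy' : |y| < R := by simpa using hy
    have hy2 : |y / 2| ≤ R := by
      rw [abs_div, abs_two]; have := abs_nonneg y; linarith
    have hp : |y / 2| ^ (2 * m + k - 1) ≤ R ^ (2 * m + k) :=
      (pow_le_pow_left₀ (abs_nonneg _) hy2 _).trans (pow_le_pow_right₀ hR1 (by omega))
    have hfac : ((m + k : ℕ) : ℝ) ≤ Nat.factorial (m + k) := by
      exact_mod_cast Nat.self_le_factorial _
    have h2 : (0 : ℝ) < Nat.factorial m := by positivity
    have h3 : (0 : ℝ) < Nat.factorial (m + k) := by positivity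
    have hcoef : ((2 * m + k : ℕ) : ℝ) * (1 / 2) ≤ Nat.factorial (m + k) := by
      refine le_trans ?_ hfac
      push_cast
      have : (0 : ℝ) ≤ k := by positivity
      linarith
    rw [norm_div, norm_mul, norm_mul, norm_mul, norm_pow, Real.norm_eq_abs (y / 2),
      RCLike.norm_natCast, RCLike.norm_natCast, RCLike.norm_natCast]
    have h12 : ‖(1 / 2 : ℝ)‖ = 1 / 2 := by norm_num
    rw [h12, div_le_iff₀ (by positivity)]
    have e : R ^ k * ((R ^ 2) ^ m / (Nat.factorial m : ℝ)) *
        ((Nat.factorial m : ℝ) * Nat.factorial (m + k)) =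
        Nat.factorial (m + k) * R ^ (2 * m + k) := by
      rw [pow_add, pow_mul]; field_simp
    rw [e]
    calc _ = (((2 * m + k : ℕ) : ℝ) * (1 / 2)) * |y / 2| ^ (2 * m + k - 1) := by ring
      _ ≤ _ := by gcongr
  refine ⟨?_, Summable.of_norm_bounded hu (fun m => hb m x hx)⟩
  refine hasDerivAt_tsum_of_isPreconnected hu Metric.isOpen_ball
    (convex_ball (0 : ℝ) R).isPreconnected ?_ hb hx (besselI_aux_summable k x) hx
  intro m y _
  exact (((hasDerivAt_id y).div_const 2).pow (2 * m + k)).div_const _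

lemma besselI_recurrence (k : ℕ) (x : ℝ) :
    ∃ d : ℝ, HasDerivAt (besselI k) d x ∧ x * d + k * besselI k x = x * besselIm1 k x := by
  obtain ⟨hd, hs⟩ := besselI_hasDerivAt_aux k x
  refine ⟨_, hd, ?_⟩
  have hs0 := besselI_aux_summable k x
  have key : ∀ m : ℕ, x * (((2 * m + k : ℕ) : ℝ) * (x / 2) ^ (2 * m + k - 1) * (1 / 2)
        / ((Nat.factorial m : ℝ) * Nat.factorial (m + k))) +
      k * ((x / 2) ^ (2 * m + k) / ((Nat.factorial m : ℝ) * Nat.factorial (m + k))) =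
      2 * (m + k : ℝ) * (x / 2) ^ (2 * m + k) /
        ((Nat.factorial m : ℝ) * Nat.factorial (m + k)) := by
    intro m
    rcases Nat.eq_zero_or_pos (2 * m + k) with h | h
    · have hm : m = 0 := by omega
      have hk : k = 0 := by omega
      subst hm; subst hk; simp
    · obtain ⟨n, hn⟩ : ∃ n, 2 * m + k = n + 1 := ⟨2 * m + k - 1, by omega⟩
      have hc : (2 * m + k : ℝ) = n + 1 := by exact_mod_cast hn
      rw [hn, Nat.add_sub_cancel, pow_succ]
      have e : 2 * (m + k : ℝ) = (n + 1) + k := by linarith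
      rw [e]
      push_cast
      ring
  have hsum : x * (∑' m : ℕ, ((2 * m + k : ℕ) : ℝ) * (x / 2) ^ (2 * m + k - 1) * (1 / 2)
        / ((Nat.factorial m : ℝ) * Nat.factorial (m + k))) + k * besselI k x =
      ∑' m : ℕ, 2 * (m + k : ℝ) * (x / 2) ^ (2 * m + k) /
        ((Nat.factorial m : ℝ) * Nat.factorial (m + k)) := by
    unfold besselI
    rw [← tsum_mul_left, ← tsum_mul_left, ← (hs.mul_left x).tsum_add (hs0.mul_left (k : ℝ))]
    exact tsum_congr key
  have hsm : Summable (fun m : ℕ => 2 * (m + k : ℝ) * (x / 2) ^ (2 * m + k) /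
        ((Nat.factorial m : ℝ) * Nat.factorial (m + k))) :=
    ((hs.mul_left x).add (hs0.mul_left (k : ℝ))).congr key
  rw [hsum]
  unfold besselIm1
  rcases k with _ | k
  · rw [hsm.tsum_eq_zero_add, if_pos rfl]
    unfold besselI
    rw [← tsum_mul_left]
    simp only [Nat.cast_zero, add_zero, mul_zero, zero_mul, zero_div, zero_add]
    refine tsum_congr fun m => ?_
    rw [Nat.factorial_succ m, show 2 * (m + 1) = (2 * m + 1) + 1 by ring, pow_succ]
    push_cast
    have h2 : (Nat.factorial m : ℝ) ≠ 0 := by positivity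
    have h3 : (m + 1 : ℝ) ≠ 0 := by positivity
    field_simp
  · rw [if_neg (by omega)]
    unfold besselI
    rw [← tsum_mul_left]
    refine tsum_congr fun m => ?_
    rw [Nat.add_sub_cancel, ← add_assoc, ← add_assoc, Nat.factorial_succ (m + k), pow_succ]
    push_cast
    have h2 : (Nat.factorial m : ℝ) ≠ 0 := by positivity
    have h4 : (Nat.factorial (m + k) : ℝ) ≠ 0 := by positivity
    have h3 : (m + k + 1 : ℝ) ≠ 0 := by positivity
    field_simp
    try ring

lemma besselK_integrable (k : ℕ) {x : ℝ} (hx : 0 < x) :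
    IntegrableOn (fun t : ℝ => Real.exp (-x * Real.cosh t) * Real.cosh (k * t)) (Set.Ioi 0) := by
  have hg : IntegrableOn (fun t : ℝ => Real.exp (2 * k ^ 2 / x) * Real.exp (-(x / 8) * t ^ 2))
      (Set.Ioi 0) :=
    ((integrable_exp_neg_mul_sq (by positivity : 0 < x / 8)).const_mul _).integrableOn
  refine Integrable.mono' hg ?_ ?_
  · refine Continuous.aestronglyMeasurable ?_
    fun_prop
  · filter_upwards [ae_restrict_mem measurableSet_Ioi] with t ht
    have ht : 0 < t := ht
    have h1 : t ^ 2 / 4 ≤ Real.cosh t := by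
      rw [Real.cosh_eq]
      have a := Real.quadratic_le_exp_of_nonneg ht.le
      have b := Real.add_one_le_exp (-t)
      linarith
    have h2 : Real.cosh (k * t) ≤ Real.exp (k * t) := by
      rw [Real.cosh_eq]
      have : Real.exp (-(k * t)) ≤ Real.exp (k * t) := by
        apply Real.exp_le_exp.2
        have : 0 ≤ (k : ℝ) * t := by positivity
        linarith
      linarith
    have h0 := Real.cosh_pos (k * t)
    rw [Real.norm_of_nonneg (by positivity), ← Real.exp_add]
    refine (mul_le_mul_of_nonneg_left h2 (Real.exp_pos _).le).trans ?_
    rw [← Real.exp_add]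
    apply Real.exp_le_exp.2
    have h3 : x * (t ^ 2 / 4) ≤ x * Real.cosh t := by gcongr
    have h4 : 0 ≤ (x * t - 4 * k) ^ 2 / (8 * x) := by positivity
    have h5 : (x * t - 4 * k) ^ 2 / (8 * x) = x * t ^ 2 / 8 - k * t + 2 * k ^ 2 / x := by
      field_simp
      ring
    nlinarith

lemma besselK_integrand_le (k : ℕ) {x₀ x : ℝ} (h : x₀ ≤ x) (t : ℝ) :
    Real.exp (-x * Real.cosh t) * Real.cosh (k * t) ≤
      Real.exp (-(x - x₀)) * (Real.exp (-x₀ * Real.cosh t) * Real.cosh (k * t)) := by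
  rw [← mul_assoc, ← Real.exp_add]
  have h0 := Real.cosh_pos (k * t)
  refine mul_le_mul_of_nonneg_right (Real.exp_le_exp.2 ?_) h0.le
  nlinarith [Real.one_le_cosh t]

lemma besselK_nonneg (k : ℕ) (x : ℝ) : 0 ≤ besselK k x :=
  integral_nonneg fun t => mul_nonneg (Real.exp_pos _).le (Real.cosh_pos _).le

lemma besselK_decay (k : ℕ) {x₀ x : ℝ} (h0 : 0 < x₀) (h : x₀ ≤ x) :
    besselK k x ≤ Real.exp (-(x - x₀)) * besselK k x₀ := by
  unfold besselK
  rw [← integral_const_mul]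
  exact integral_mono (besselK_integrable k (h0.trans_le h))
    ((besselK_integrable k h0).const_mul _) (besselK_integrand_le k h)

lemma besselK_continuousOn (k : ℕ) {x₀ : ℝ} (h0 : 0 < x₀) :
    ContinuousOn (besselK k) (Set.Ici x₀) := by
  unfold besselK
  refine continuousOn_of_dominated
    (bound := fun t => Real.exp (-x₀ * Real.cosh t) * Real.cosh (k * t)) ?_ ?_
    (besselK_integrable k h0) ?_
  · intro x _
    refine Continuous.aestronglyMeasurable ?_
    fun_prop
  · intro x hx
    refine Eventually.of_forall fun t => ?_
    have hp := Real.cosh_pos (k * t)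
    rw [Real.norm_of_nonneg (by positivity)]
    refine (besselK_integrand_le k hx t).trans ?_
    refine mul_le_of_le_one_left (by positivity) (Real.exp_le_one_iff.2 ?_)
    have : x₀ ≤ x := hx
    linarith
  · refine Eventually.of_forall fun t => Continuous.continuousOn ?_
    fun_prop

lemma besselI_continuous (k : ℕ) : Continuous (besselI k) :=
  continuous_iff_continuousAt.2 fun x => (besselI_hasDerivAt_aux k x).1.continuousAt

lemma particular_integrable (r₀ τ : ℝ) (hr₀ : 0 < r₀) (hτ : 0 < τ) (k : ℕ)
    (f : ℝ → ℂ)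
    (hL1 : IntegrableOn (fun s : ℝ => (Real.sqrt s : ℂ) * f s) (Set.Ioi r₀))
    (hK : ContinuousOn (fun s : ℝ => besselK k (Real.sqrt τ * s)) (Set.Ici r₀)) :
    IntegrableOn (fun s : ℝ => f s * (besselK k (Real.sqrt τ * s) : ℂ) * (s : ℂ))
      (Set.Ioi r₀) := by
  have hq : 0 < Real.sqrt τ := Real.sqrt_pos.2 hτ
  set q := Real.sqrt τ
  have hm : AEStronglyMeasurable (fun s : ℝ => ((Real.sqrt s * besselK k (q * s) : ℝ) : ℂ))
      (volume.restrict (Set.Ioi r₀)) := by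
    refine ContinuousOn.aestronglyMeasurable ?_ measurableSet_Ioi
    refine Complex.continuous_ofReal.comp_continuousOn ?_
    exact Real.continuous_sqrt.continuousOn.mul (hK.mono Ioi_subset_Ici_self)
  have hbd : ∀ᵐ s ∂(volume.restrict (Set.Ioi r₀)),
      ‖((Real.sqrt s * besselK k (q * s) : ℝ) : ℂ)‖ ≤ (1 + r₀ + 1 / q) * besselK k (q * r₀) := by
    filter_upwards [ae_restrict_mem measurableSet_Ioi] with s hs
    have hs : r₀ < s := hs
    have hs0 : 0 < s := hr₀.trans hs
    have hd := besselK_decay k (x₀ := q * r₀) (x := q * s) (by positivity) (by gcongr)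
    have hn := besselK_nonneg k (q * s)
    have hn0 := besselK_nonneg k (q * r₀)
    rw [Complex.norm_real, Real.norm_of_nonneg (by positivity)]
    refine (mul_le_mul_of_nonneg_left hd (Real.sqrt_nonneg _)).trans ?_
    rw [← mul_assoc]
    refine mul_le_mul_of_nonneg_right ?_ hn0
    have hsq : Real.sqrt s ≤ 1 + s := by
      rw [Real.sqrt_le_left (by positivity)]
      nlinarith
    rw [Real.exp_neg, ← div_eq_mul_inv, div_le_iff₀ (Real.exp_pos _)]
    have hE := Real.add_one_le_exp (q * s - q * r₀)
    set E := Real.exp (q * s - q * r₀)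
    have hpos : 0 ≤ q * (s - r₀) := mul_nonneg hq.le (by linarith)
    have hE1 : 1 ≤ E := by linarith
    have hE2 : s - r₀ ≤ 1 / q * E := by
      rw [one_div, ← div_eq_inv_mul, le_div_iff₀ hq]
      linarith
    nlinarith
  refine (hL1.bdd_mul hm hbd).congr ?_
  filter_upwards [ae_restrict_mem measurableSet_Ioi] with s hs
  have hs : r₀ < s := hs
  have e : (Real.sqrt s : ℂ) * (Real.sqrt s : ℂ) = (s : ℂ) := by
    rw [← Complex.ofReal_mul, Real.mul_self_sqrt (hr₀.trans hs).le]
  rw [← e]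
  push_cast
  ring

lemma ftc_right (r₀ : ℝ) (g : ℝ → ℂ) (hg : ContinuousOn g (Set.Ici r₀)) :
    HasDerivWithinAt (fun r => ∫ s in r₀..r, g s) (g r₀) (Set.Ici r₀) r₀ := by
  refine intervalIntegral.integral_hasDerivWithinAt_right (t := Set.Ioi r₀)
    IntervalIntegrable.refl ?_ ?_
  · refine ⟨Set.Ioi r₀, self_mem_nhdsWithin, ?_⟩
    exact (hg.mono Ioi_subset_Ici_self).aestronglyMeasurable measurableSet_Ioi
  · exact (hg r₀ self_mem_Ici).mono Ioi_subset_Ici_self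

theorem boundary_operator_on_particularSol (r₀ τ : ℝ) (hr₀ : 0 < r₀) (hτ : 0 < τ) (k : ℕ)
    (f : ℝ → ℂ) (hf : ContinuousOn f (Set.Ici r₀))
    (hL1 : IntegrableOn (fun s : ℝ => (Real.sqrt s : ℂ) * f s) (Set.Ioi r₀)) :
    (r₀ : ℂ) * derivWithin (particularSol r₀ τ k f) (Set.Ici r₀) r₀
        + (k : ℂ) * particularSol r₀ τ k f r₀
      = (r₀ : ℂ) * (Real.sqrt τ : ℂ) * (besselIm1 k (Real.sqrt τ * r₀) : ℂ) *
          ∫ s in Set.Ioi r₀, f s * (besselK k (Real.sqrt τ * s) : ℂ) * (s : ℂ) := by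
  have hq : 0 < Real.sqrt τ := Real.sqrt_pos.2 hτ
  have hK : ContinuousOn (fun s : ℝ => besselK k (Real.sqrt τ * s)) (Set.Ici r₀) := by
    refine (besselK_continuousOn k (x₀ := Real.sqrt τ * r₀) (by positivity)).comp
      (by fun_prop) ?_
    intro s hs
    have hs : r₀ ≤ s := hs
    show Real.sqrt τ * r₀ ≤ Real.sqrt τ * s
    gcongr
  have hint := particular_integrable r₀ τ hr₀ hτ k f hL1 hK
  obtain ⟨d, hd, hrec⟩ := besselI_recurrence k (Real.sqrt τ * r₀)
  set q := Real.sqrt τ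
  have hKc : ContinuousOn (fun s : ℝ => (besselK k (q * s) : ℂ)) (Set.Ici r₀) :=
    Complex.continuous_ofReal.comp_continuousOn hK
  have hIc : Continuous (fun s : ℝ => (besselI k (q * s) : ℂ)) :=
    Complex.continuous_ofReal.comp ((besselI_continuous k).comp (by fun_prop))
  have hsc : Continuous (fun s : ℝ => (s : ℂ)) := Complex.continuous_ofReal
  have hA := ftc_right r₀ (fun s => f s * (besselI k (q * s) : ℂ) * (s : ℂ))
    ((hf.mul hIc.continuousOn).mul hsc.continuousOn)
  have hB := ftc_right r₀ (fun s => f s * (besselK k (q * s) : ℂ) * (s : ℂ))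
    ((hf.mul hKc).mul hsc.continuousOn)
  have hI : HasDerivWithinAt (fun r : ℝ => (besselI k (q * r) : ℂ)) ((d * q : ℝ) : ℂ)
      (Set.Ici r₀) r₀ := by
    have h1 : HasDerivAt (fun r : ℝ => besselI k (q * r)) (d * q) r₀ := by
      have h2 : HasDerivAt (fun r : ℝ => q * r) q r₀ := by
        simpa using (hasDerivAt_id r₀).const_mul q
      exact HasDerivAt.comp r₀ hd h2
    exact h1.ofReal_comp.hasDerivWithinAt
  -- the first product: only continuity of `K` is needed since the integral vanishes at `r₀`
  have hP1 : HasDerivWithinAt (fun r : ℝ => (besselK k (q * r) : ℂ) *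
      (∫ s in r₀..r, f s * (besselI k (q * s) : ℂ) * (s : ℂ)))
      ((besselK k (q * r₀) : ℂ) * (f r₀ * (besselI k (q * r₀) : ℂ) * (r₀ : ℂ)))
      (Set.Ici r₀) r₀ := by
    rw [hasDerivWithinAt_iff_tendsto_slope] at hA ⊢
    have hk' : Tendsto (fun s : ℝ => (besselK k (q * s) : ℂ)) (nhdsWithin r₀ (Set.Ici r₀ \ {r₀}))
        (nhds (besselK k (q * r₀) : ℂ)) :=
      (hKc r₀ self_mem_Ici).mono_left (nhdsWithin_mono _ diff_subset)
    refine (hk'.mul hA).congr fun r => ?_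
    simp only [slope, vsub_eq_sub, intervalIntegral.integral_same, mul_zero, sub_zero,
      Complex.real_smul]
    ring
  have hT : HasDerivWithinAt (fun r : ℝ => ∫ s in Set.Ioi r,
      f s * (besselK k (q * s) : ℂ) * (s : ℂ))
      (-(f r₀ * (besselK k (q * r₀) : ℂ) * (r₀ : ℂ))) (Set.Ici r₀) r₀ := by
    have h1 := hB.const_sub (∫ s in Set.Ioi r₀, f s * (besselK k (q * s) : ℂ) * (s : ℂ))
    refine h1.congr_of_mem (fun r hr => ?_) self_mem_Ici
    rw [← intervalIntegral.integral_Ioi_sub_Ioi hint hr]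
    ring
  have hD := (hP1.add (hI.mul hT)).derivWithin (uniqueDiffOn_Ici r₀ r₀ self_mem_Ici)
  have hD' : derivWithin (particularSol r₀ τ k f) (Set.Ici r₀) r₀ =
      ((d * q : ℝ) : ℂ) * ∫ s in Set.Ioi r₀, f s * (besselK k (q * s) : ℂ) * (s : ℂ) := by
    refine Eq.trans hD ?_
    ring
  have hv : particularSol r₀ τ k f r₀ = (besselI k (q * r₀) : ℂ) *
      ∫ s in Set.Ioi r₀, f s * (besselK k (q * s) : ℂ) * (s : ℂ) := by
    simp [particularSol, q]
  rw [hD', hv]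
  have hrec' : ((q : ℂ) * r₀) * d + k * (besselI k (q * r₀) : ℂ) =
      (q : ℂ) * r₀ * (besselIm1 k (q * r₀) : ℂ) := by exact_mod_cast congrArg Complex.ofReal hrec
  push_cast
  linear_combination (∫ s in Set.Ioi r₀, f s * (besselK k (q * s) : ℂ) * (s : ℂ)) * hrec'
end

section
/- Fix r_0 > 0, τ > 0 and an integer k ≥ 0. Let f : [r_0, ∞) → ℂ be continuous with √s·f(s) ∈ L¹(r_0, ∞). Then the function u(r) = (K_k(√τ·r)·I_{k−1}(√τ·r_0)/K_{k−1}(√τ·r_0))·∫_{r_0}^∞ f(s)·K_k(√τ·s)·s ds + K_k(√τ·r)·∫_{r_0}^r f(s)·I_k(√τ·s)·s ds + I_k(√τ·r)·∫_r^∞ f(s)·K_k(√τ·s)·s ds satisfies: (i) u''(r) + u'(r)/r − (k²/r² + τ)·u(r) = −f(r) for all r > r_0; (ii) the Robin-type boundary condition r_0·u'(r_0) + k·u(r_0) = 0; (iii) u(r) → 0 as r → ∞. -/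
open Complex Set Filter MeasureTheory

/-- `K_{k−1}`, with the convention `K_{−1} = K_1`. -/
noncomputable def besselKm1 (k : ℕ) : ℝ → ℝ :=
  if k = 0 then besselK 1 else besselK (k - 1)

/-- The resolvent solution `u` of the inhomogeneous modified Bessel equation with
Robin-type boundary condition. -/
noncomputable def resolventSol (r₀ τ : ℝ) (k : ℕ) (f : ℝ → ℂ) (r : ℝ) : ℂ :=
  ((besselK k (Real.sqrt τ * r) : ℂ) * (besselIm1 k (Real.sqrt τ * r₀) : ℂ)
        / (besselKm1 k (Real.sqrt τ * r₀) : ℂ)) *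
      (∫ s in Set.Ioi r₀, f s * (besselK k (Real.sqrt τ * s) : ℂ) * (s : ℂ))
    + (besselK k (Real.sqrt τ * r) : ℂ) *
      (∫ s in r₀..r, f s * (besselI k (Real.sqrt τ * s) : ℂ) * (s : ℂ))
    + (besselI k (Real.sqrt τ * r) : ℂ) *
      (∫ s in Set.Ioi r, f s * (besselK k (Real.sqrt τ * s) : ℂ) * (s : ℂ))

lemma hasDerivAt_exp_aux (R : ℝ) (k : ℕ) :
    Summable (fun m : ℕ => R ^ m / ((Nat.factorial m : ℝ) * Nat.factorial (m + k))) := by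
  refine Summable.of_norm_bounded (g := fun m : ℕ => |R| ^ m / (Nat.factorial m : ℝ))
    (Real.summable_pow_div_factorial |R|) ?_
  intro m
  rw [norm_div, norm_pow, Real.norm_eq_abs, Real.norm_eq_abs,
    abs_of_pos (a := (Nat.factorial m : ℝ) * _) (by positivity)]
  have h1 : (1 : ℝ) ≤ Nat.factorial (m + k) := by
    exact_mod_cast Nat.factorial_pos _
  have h2 : (0 : ℝ) < Nat.factorial m := by exact_mod_cast Nat.factorial_pos _
  refine div_le_div_of_nonneg_left (by positivity) h2 ?_
  nlinarith

/-- auxiliary entire function -/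
noncomputable def gI (k : ℕ) (y : ℝ) : ℝ :=
  ∑' m : ℕ, y ^ m / ((Nat.factorial m : ℝ) * Nat.factorial (m + k))

lemma gI_rec (k : ℕ) (y : ℝ) : gI k y = y * gI (k + 2) y + (k + 1) * gI (k + 1) y := by
  unfold gI
  rw [(hasDerivAt_exp_aux y k).tsum_eq_zero_add,
    (hasDerivAt_exp_aux y (k+1)).tsum_eq_zero_add, mul_add, ← tsum_mul_left, ← tsum_mul_left,
    add_left_comm, ← Summable.tsum_add]
  · congr 1
    · simp [Nat.factorial_succ]
      field_simp
    · congr 1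
      ext m
      have e1 : m + 1 + k = m + k + 1 := by ring
      have e2 : m + 1 + (k + 1) = m + k + 1 + 1 := by ring
      have e3 : m + (k + 2) = m + k + 1 + 1 := by ring
      rw [e1, e2, e3]
      simp only [Nat.factorial_succ]
      push_cast
      field_simp
      ring
  · exact (hasDerivAt_exp_aux y (k + 2)).mul_left _
  · exact ((summable_nat_add_iff 1).2 (hasDerivAt_exp_aux y (k + 1))).mul_left _

lemma gI_hasDerivAt (k : ℕ) (y : ℝ) : HasDerivAt (gI k) (gI (k + 1) y) y := by
  have key : HasDerivAt (gI k)
      (∑' m : ℕ, (m : ℝ) * y ^ (m - 1) / ((Nat.factorial m : ℝ) * Nat.factorial (m + k))) y := by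
    unfold gI
    have hs : Summable (fun m : ℕ =>
        (m : ℝ) * (|y| + 1) ^ (m - 1) / ((Nat.factorial m : ℝ) * Nat.factorial (m + k))) := by
      rw [← summable_nat_add_iff 1]
      refine (hasDerivAt_exp_aux (|y| + 1) (k + 1)).congr ?_
      intro m
      have e2 : m + 1 + k = m + (k + 1) := by ring
      rw [e2, Nat.factorial_succ m]
      push_cast
      field_simp
    have hy0 : y ∈ Metric.ball (0 : ℝ) (|y| + 1) := by simp
    refine hasDerivAt_tsum_of_isPreconnected
      (g := fun (m : ℕ) (y : ℝ) => y ^ m / ((Nat.factorial m : ℝ) * Nat.factorial (m + k)))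
      (g' := fun (m : ℕ) (y : ℝ) =>
        (m : ℝ) * y ^ (m - 1) / ((Nat.factorial m : ℝ) * Nat.factorial (m + k)))
      (t := Metric.ball 0 (|y| + 1)) (y₀ := y) (y := y)
      hs Metric.isOpen_ball
      (convex_ball 0 _).isPreconnected ?_ ?_ hy0 (hasDerivAt_exp_aux y k) hy0
    · intro m z _
      exact (hasDerivAt_pow m z).div_const _
    · intro m z hz
      have hz' : |z| ≤ |y| + 1 := by
        have := Metric.mem_ball.1 hz
        rw [dist_zero_right, Real.norm_eq_abs] at this
        exact this.le
      rw [norm_div, norm_mul, norm_pow, Real.norm_eq_abs, Real.norm_eq_abs, Real.norm_eq_abs,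
        abs_of_nonneg (Nat.cast_nonneg m), abs_of_pos (a := (Nat.factorial m : ℝ) * _) (by positivity)]
      gcongr
  convert key using 1
  have hs : Summable (fun m : ℕ =>
        (m : ℝ) * y ^ (m - 1) / ((Nat.factorial m : ℝ) * Nat.factorial (m + k))) := by
      rw [← summable_nat_add_iff 1]
      refine (hasDerivAt_exp_aux y (k + 1)).congr ?_
      intro m
      have e2 : m + 1 + k = m + (k + 1) := by ring
      rw [e2, Nat.factorial_succ m]
      push_cast
      field_simp
  rw [hs.tsum_eq_zero_add]
  simp only [CharP.cast_eq_zero, zero_mul, zero_div, zero_add]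
  unfold gI
  congr 1
  ext m
  have e2 : m + 1 + k = m + (k + 1) := by ring
  rw [e2, Nat.factorial_succ m]
  push_cast
  field_simp

lemma besselI_eq (k : ℕ) (x : ℝ) : besselI k x = (x / 2) ^ k * gI k ((x / 2) ^ 2) := by
  unfold besselI gI
  rw [← tsum_mul_left]
  congr 1
  ext m
  rw [pow_add, pow_mul]
  ring

lemma besselI_rec (k : ℕ) {x : ℝ} (hx : 0 < x) :
    besselI (k + 2) x = besselI k x - 2 * (k + 1) / x * besselI (k + 1) x := by
  simp only [besselI_eq]
  rw [gI_rec k]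
  field_simp
  ring

lemma besselI_hasDerivAt (k : ℕ) {x : ℝ} (hx : 0 < x) :
    HasDerivAt (besselI k) (besselI (k + 1) x + k / x * besselI k x) x := by
  have h2 : HasDerivAt (fun x : ℝ => x / 2) (1 / 2) x := (hasDerivAt_id x).div_const 2
  have h := (h2.pow k).mul ((gI_hasDerivAt k ((x / 2) ^ 2)).comp x (h2.pow 2))
  have e : besselI k = ((fun x : ℝ => x / 2) ^ k * (gI k ∘ ((fun x : ℝ => x / 2) ^ 2))) := by
    ext x; simp [besselI_eq]
  refine (e ▸ h : HasDerivAt (besselI k) _ x).congr_deriv ?_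
  rw [besselI_eq, besselI_eq]
  rcases k with _ | k
  · simp; ring
  · simp; field_simp; ring

lemma gI_pos (k : ℕ) {y : ℝ} (hy : 0 ≤ y) : 0 < gI k y := by
  unfold gI
  refine (hasDerivAt_exp_aux y k).tsum_pos (fun m => by positivity) 0 (by positivity)

lemma gI_mono (k : ℕ) {y z : ℝ} (hy : 0 ≤ y) (h : y ≤ z) : gI k y ≤ gI k z := by
  unfold gI
  refine (hasDerivAt_exp_aux y k).tsum_le_tsum ?_ (hasDerivAt_exp_aux z k)
  intro m
  gcongr

lemma besselI_pos (k : ℕ) {x : ℝ} (hx : 0 < x) : 0 < besselI k x := by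
  rw [besselI_eq]
  have := gI_pos k (y := (x / 2) ^ 2) (by positivity)
  positivity

lemma besselI_mono (k : ℕ) {x y : ℝ} (hx : 0 < x) (h : x ≤ y) : besselI k x ≤ besselI k y := by
  rw [besselI_eq, besselI_eq]
  have := gI_pos k (y := (x / 2) ^ 2) (by positivity)
  have := gI_mono k (y := (x / 2) ^ 2) (z := (y / 2) ^ 2) (by positivity) (by gcongr)
  have hy : 0 < y := hx.trans_le h
  gcongr

lemma besselI_zero_zero : besselI 0 0 = 1 := by
  rw [besselI_eq]; unfold gI
  rw [(hasDerivAt_exp_aux _ 0).tsum_eq_zero_add]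
  simp

lemma besselI_one_zero : besselI 1 0 = 0 := by
  rw [besselI_eq]; simp

lemma sq_le_cosh (t : ℝ) (ht : 0 ≤ t) : t ^ 2 / 2 ≤ Real.cosh t := by
  have h := Real.quadratic_le_exp_of_nonneg ht
  rw [Real.cosh_eq]
  have h2 : 1 - t ≤ Real.exp (-t) := by linarith [Real.add_one_le_exp (-t)]
  have h3 := Real.cosh_sq t
  have h4 : t ≤ Real.sinh t := by
    rcases ht.eq_or_lt with rfl | h
    · simp
    · exact (Real.self_lt_sinh_iff.2 h).le
  have h5 : Real.cosh t = (Real.exp t + Real.exp (-t)) / 2 := Real.cosh_eq t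
  rw [← h5]
  have h6 := Real.one_le_cosh t
  by_cases h7 : t ≤ 2
  · nlinarith
  · rw [h5]
    have h8 := Real.sum_le_exp_of_nonneg ht 5
    simp [Finset.sum_range_succ, Nat.factorial] at h8
    have := Real.exp_pos (-t)
    nlinarith [sq_nonneg t, sq_nonneg (t - 2), mul_nonneg ht (sq_nonneg t)]

/-- Basic dominating bound. -/
lemma exp_cosh_bound (n : ℕ) {x t : ℝ} (hx : 0 < x) (ht : 0 ≤ t) :
    Real.exp (-x * Real.cosh t) * Real.exp (n * t) ≤
      Real.exp ((n + 1) ^ 2 / (2 * x)) * Real.exp (-t) := by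
  rw [← Real.exp_add, ← Real.exp_add]
  apply Real.exp_le_exp.2
  have h := sq_le_cosh t ht
  have h2 : x * (t ^ 2 / 2) ≤ x * Real.cosh t := by gcongr
  have h3 : (n + 1) * t ≤ (n + 1 : ℝ) ^ 2 / (2 * x) + x * (t ^ 2 / 2) := by
    rw [← sub_nonneg]
    have : (n + 1 : ℝ) ^ 2 / (2 * x) + x * (t ^ 2 / 2) - (n + 1) * t
      = (n + 1 - x * t) ^ 2 / (2 * x) := by field_simp; ring
    rw [this]; positivity
  linarith

lemma exp_cosh_integrable (n : ℕ) {x : ℝ} (hx : 0 < x) {g : ℝ → ℝ} (hg : Continuous g)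
    (hb : ∀ t, 0 ≤ t → |g t| ≤ Real.exp (n * t)) :
    IntegrableOn (fun t => Real.exp (-x * Real.cosh t) * g t) (Set.Ioi (0 : ℝ)) := by
  refine Integrable.mono' ((integrableOn_exp_neg_Ioi 0).const_mul
    (Real.exp ((n + 1) ^ 2 / (2 * x)))) ?_ ?_
  · have : Continuous (fun t => Real.exp (-x * Real.cosh t) * g t) := by fun_prop
    exact this.aestronglyMeasurable
  · refine (ae_restrict_iff' measurableSet_Ioi).2 (Eventually.of_forall fun t ht => ?_)
    have ht' : 0 ≤ t := le_of_lt ht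
    rw [norm_mul, Real.norm_eq_abs, Real.norm_eq_abs, abs_of_pos (Real.exp_pos _)]
    exact (mul_le_mul_of_nonneg_left (hb t ht') (Real.exp_pos _).le).trans
      (exp_cosh_bound n hx ht')

lemma exp_cosh_tendsto (n : ℕ) {x : ℝ} (hx : 0 < x) {g : ℝ → ℝ}
    (hb : ∀ t, 0 ≤ t → |g t| ≤ Real.exp (n * t)) :
    Tendsto (fun t => Real.exp (-x * Real.cosh t) * g t) atTop (nhds 0) := by
  have h0 : Tendsto (fun t => Real.exp ((n + 1) ^ 2 / (2 * x)) * Real.exp (-t)) atTop (nhds 0) := by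
    simpa using (Real.tendsto_exp_neg_atTop_nhds_zero).const_mul (Real.exp ((n + 1) ^ 2 / (2 * x)))
  refine squeeze_zero_norm' ?_ h0
  filter_upwards [eventually_ge_atTop 0] with t ht'
  rw [norm_mul, Real.norm_eq_abs, Real.norm_eq_abs, abs_of_pos (Real.exp_pos _)]
  exact (mul_le_mul_of_nonneg_left (hb t ht') (Real.exp_pos _).le).trans
      (exp_cosh_bound n hx ht')

lemma abs_cosh_le (k : ℕ) (t : ℝ) (ht : 0 ≤ t) : |Real.cosh (k * t)| ≤ Real.exp (k * t) := by
  rw [abs_of_pos (Real.cosh_pos _), Real.cosh_eq]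
  have : Real.exp (-(k * t)) ≤ Real.exp (k * t) := Real.exp_le_exp.2 (by
    have : 0 ≤ (k : ℝ) * t := by positivity
    linarith)
  linarith

lemma abs_sinh_le (k : ℕ) (t : ℝ) (ht : 0 ≤ t) : |Real.sinh (k * t)| ≤ Real.exp (k * t) := by
  have h0 : 0 ≤ (k : ℝ) * t := by positivity
  rw [abs_of_nonneg (Real.sinh_nonneg_iff.2 h0), Real.sinh_eq]
  have := Real.exp_pos (-(k * t))
  have := Real.exp_pos ((k * t))
  linarith

lemma abs_cosh_le' (t : ℝ) (ht : 0 ≤ t) : |Real.cosh t| ≤ Real.exp t := by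
  simpa using abs_cosh_le 1 t ht

lemma abs_sinh_le' (t : ℝ) (ht : 0 ≤ t) : |Real.sinh t| ≤ Real.exp t := by
  simpa using abs_sinh_le 1 t ht

lemma abs_mul_exp_le (k : ℕ) {a b t : ℝ} (ha : |a| ≤ Real.exp (k * t)) (hb : |b| ≤ Real.exp t) :
    |a * b| ≤ Real.exp ((k + 1 : ℕ) * t) := by
  rw [abs_mul]
  push_cast
  rw [add_mul, one_mul, Real.exp_add]
  gcongr

lemma besselK_int (k : ℕ) {x : ℝ} (hx : 0 < x) :
    IntegrableOn (fun t => Real.exp (-x * Real.cosh t) * Real.cosh (k * t)) (Set.Ioi (0 : ℝ)) :=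
  exp_cosh_integrable k hx (by fun_prop) (abs_cosh_le k)

lemma besselK_int_cc (k : ℕ) {x : ℝ} (hx : 0 < x) :
    IntegrableOn (fun t => Real.exp (-x * Real.cosh t) * (Real.cosh (k * t) * Real.cosh t))
      (Set.Ioi (0 : ℝ)) :=
  exp_cosh_integrable (k + 1) hx (by fun_prop)
    (fun t ht => abs_mul_exp_le k (abs_cosh_le k t ht) (abs_cosh_le' t ht))

lemma besselK_int_ss (k : ℕ) {x : ℝ} (hx : 0 < x) :
    IntegrableOn (fun t => Real.exp (-x * Real.cosh t) * (Real.sinh (k * t) * Real.sinh t))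
      (Set.Ioi (0 : ℝ)) :=
  exp_cosh_integrable (k + 1) hx (by fun_prop)
    (fun t ht => abs_mul_exp_le k (abs_sinh_le k t ht) (abs_sinh_le' t ht))

lemma besselK_parts (k : ℕ) {x : ℝ} (hx : 0 < x) :
    ∫ t in Set.Ioi (0 : ℝ), Real.exp (-x * Real.cosh t) * (Real.sinh (k * t) * Real.sinh t)
      = k / x * besselK k x := by
  have h := integral_Ioi_of_hasDerivAt_of_tendsto' (a := 0) (m := 0)
    (f := fun t => Real.exp (-x * Real.cosh t) * Real.sinh (k * t))
    (f' := fun t => k * (Real.exp (-x * Real.cosh t) * Real.cosh (k * t)) -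
      x * (Real.exp (-x * Real.cosh t) * (Real.sinh (k * t) * Real.sinh t)))
    (fun t _ => by
      have h1 : HasDerivAt (fun t => Real.exp (-x * Real.cosh t))
        (Real.exp (-x * Real.cosh t) * (-x * Real.sinh t)) t :=
        ((Real.hasDerivAt_cosh t).const_mul (-x)).exp
      have h2 : HasDerivAt (fun t => Real.sinh (k * t)) (Real.cosh (k * t) * (k * 1)) t :=
        ((hasDerivAt_id t).const_mul (k : ℝ)).sinh
      refine (h1.mul h2).congr_deriv ?_
      ring)
    (((besselK_int k hx).const_mul _).sub ((besselK_int_ss k hx).const_mul _))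
    (exp_cosh_tendsto k hx (abs_sinh_le k))
  rw [integral_sub ((besselK_int k hx).const_mul _) ((besselK_int_ss k hx).const_mul _),
    integral_const_mul, integral_const_mul] at h
  simp only [mul_zero, Real.sinh_zero, sub_zero] at h
  unfold besselK
  rw [div_mul_eq_mul_div, eq_div_iff hx.ne']
  linarith

lemma besselK_cc (k : ℕ) {x : ℝ} (hx : 0 < x) :
    ∫ t in Set.Ioi (0 : ℝ), Real.exp (-x * Real.cosh t) * (Real.cosh (k * t) * Real.cosh t)
      = besselK (k + 1) x - k / x * besselK k x := by
  rw [← besselK_parts k hx]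
  unfold besselK
  rw [← integral_sub (besselK_int (k + 1) hx) (besselK_int_ss k hx)]
  congr 1
  ext t
  push_cast
  rw [add_mul, one_mul, Real.cosh_add]
  ring

lemma besselK_rec (k : ℕ) {x : ℝ} (hx : 0 < x) :
    besselK (k + 2) x = besselK k x + 2 * (k + 1) / x * besselK (k + 1) x := by
  have h := besselK_parts (k + 1) hx
  have h2 : besselK (k + 2) x - besselK k x = 2 * ∫ t in Set.Ioi (0 : ℝ),
      Real.exp (-x * Real.cosh t) * (Real.sinh ((k + 1 : ℕ) * t) * Real.sinh t) := by
    unfold besselK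
    rw [← integral_sub (besselK_int (k + 2) hx) (besselK_int k hx), ← integral_const_mul]
    congr 1
    ext t
    have e1 : ((k + 2 : ℕ) : ℝ) * t = (k + 1 : ℕ) * t + t := by push_cast; ring
    have e2 : (k : ℝ) * t = (k + 1 : ℕ) * t - t := by push_cast; ring
    rw [e1, e2, Real.cosh_add, Real.cosh_sub]
    ring
  rw [h] at h2
  push_cast at h2
  linear_combination h2

lemma besselK_hasDerivAt (k : ℕ) {x : ℝ} (hx : 0 < x) :
    HasDerivAt (besselK k) (-besselK (k + 1) x + k / x * besselK k x) x := by
  have hm : ∀ y, AEStronglyMeasurable (fun t => Real.exp (-y * Real.cosh t) * Real.cosh (k * t))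
      (volume.restrict (Set.Ioi (0 : ℝ))) := fun y => by
    have : Continuous (fun t => Real.exp (-y * Real.cosh t) * Real.cosh (k * t)) := by fun_prop
    exact this.aestronglyMeasurable
  have hm' : AEStronglyMeasurable
      (fun t => -(Real.exp (-x * Real.cosh t) * (Real.cosh (k * t) * Real.cosh t)))
      (volume.restrict (Set.Ioi (0 : ℝ))) := by
    have : Continuous
      (fun t => -(Real.exp (-x * Real.cosh t) * (Real.cosh (k * t) * Real.cosh t))) := by fun_prop
    exact this.aestronglyMeasurable
  have h := (hasDerivAt_integral_of_dominated_loc_of_deriv_le (𝕜 := ℝ)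
    (μ := volume.restrict (Set.Ioi (0 : ℝ))) (x₀ := x) (s := Set.Ioi (x / 2))
    (F := fun y t => Real.exp (-y * Real.cosh t) * Real.cosh (k * t))
    (F' := fun y t => -(Real.exp (-y * Real.cosh t) * (Real.cosh (k * t) * Real.cosh t)))
    (bound := fun t => Real.exp (-(x / 2) * Real.cosh t) * (Real.cosh (k * t) * Real.cosh t))
    (Ioi_mem_nhds (by linarith)) (Eventually.of_forall hm) (besselK_int k hx) hm'
    (Eventually.of_forall fun t y hy => by
      rw [norm_neg, Real.norm_eq_abs, abs_of_pos (by positivity)]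
      have : x / 2 ≤ y := le_of_lt hy
      have : 0 < Real.cosh t := Real.cosh_pos t
      gcongr)
    (besselK_int_cc k (by linarith))
    (Eventually.of_forall fun t y _ => by
      have h1 : HasDerivAt (fun y : ℝ => -y * Real.cosh t) (-1 * Real.cosh t) y :=
        (hasDerivAt_neg y).mul_const _
      refine (h1.exp.mul_const _).congr_deriv ?_
      ring)).2
  rw [integral_neg, besselK_cc k hx] at h
  refine h.congr_deriv ?_
  ring

lemma besselK_pos (k : ℕ) {x : ℝ} (hx : 0 < x) : 0 < besselK k x := by
  unfold besselK
  rw [setIntegral_pos_iff_support_of_nonneg_ae _ (besselK_int k hx)]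
  · have : Function.support (fun t => Real.exp (-x * Real.cosh t) * Real.cosh (k * t)) = univ := by
      ext t
      simp [Real.exp_ne_zero, (Real.cosh_pos _).ne']
    rw [this]; simp
  · exact Eventually.of_forall fun t => by
      have := Real.cosh_pos (k * t)
      simp only [Pi.zero_apply]
      positivity

lemma besselK_le_succ (k : ℕ) {x : ℝ} (hx : 0 < x) : besselK k x ≤ besselK (k + 1) x := by
  unfold besselK
  refine setIntegral_mono_on (besselK_int k hx) (besselK_int _ hx) measurableSet_Ioi ?_
  intro t ht
  have ht : 0 < t := ht
  gcongr
  rw [Real.cosh_le_cosh, abs_of_nonneg (by positivity), abs_of_nonneg (by positivity)]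
  push_cast
  gcongr
  linarith

lemma besselK_one_tendsto :
    Tendsto (fun x : ℝ => x * besselK 1 x) (nhdsWithin 0 (Set.Ioi 0)) (nhds 1) := by
  have hIntg : ∀ {x : ℝ}, 0 < x → IntegrableOn (fun t => Real.exp (-x * Real.cosh t) * Real.sinh t)
      (Set.Ioi (0 : ℝ)) := fun {x} hx =>
    exp_cosh_integrable 1 hx (by fun_prop) (by simpa using abs_sinh_le')
  have hs : ∀ {x : ℝ}, 0 < x → x * ∫ t in Set.Ioi (0 : ℝ), Real.exp (-x * Real.cosh t) * Real.sinh t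
      = Real.exp (-x) := by
    intro x hx
    have h := integral_Ioi_of_hasDerivAt_of_tendsto' (a := 0) (m := 0)
      (f := fun t => -(Real.exp (-x * Real.cosh t) * 1))
      (f' := fun t => x * (Real.exp (-x * Real.cosh t) * Real.sinh t))
      (fun t _ => by
        have h1 : HasDerivAt (fun t => Real.exp (-x * Real.cosh t))
          (Real.exp (-x * Real.cosh t) * (-x * Real.sinh t)) t :=
          ((Real.hasDerivAt_cosh t).const_mul (-x)).exp
        refine (h1.mul_const 1).neg.congr_deriv ?_
        ring)
      ((hIntg hx).const_mul _)
      (by simpa using (exp_cosh_tendsto 0 hx (g := fun _ => 1) (by simp)).neg)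
    rw [integral_const_mul] at h
    simpa using h
  have hlow : ∀ᶠ x : ℝ in nhdsWithin 0 (Set.Ioi 0), Real.exp (-x) ≤ x * besselK 1 x := by
    filter_upwards [self_mem_nhdsWithin] with x hx
    have hx : 0 < x := hx
    rw [← hs hx]
    unfold besselK
    refine mul_le_mul_of_nonneg_left ?_ hx.le
    refine integral_mono (hIntg hx) (besselK_int 1 hx) ?_
    intro t
    simp only [Nat.cast_one, one_mul]
    gcongr
    exact (Real.sinh_lt_cosh t).le
  have hup : ∀ᶠ x : ℝ in nhdsWithin 0 (Set.Ioi 0), x * besselK 1 x ≤ Real.exp (-x) + x := by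
    filter_upwards [self_mem_nhdsWithin] with x hx
    have hx : 0 < x := hx
    have : besselK 1 x ≤
        (∫ t in Set.Ioi (0 : ℝ), Real.exp (-x * Real.cosh t) * Real.sinh t) + 1 := by
      rw [← integral_exp_neg_Ioi_zero, ← integral_add (hIntg hx) (integrableOn_exp_neg_Ioi 0)]
      unfold besselK
      refine integral_mono (besselK_int 1 hx) ((hIntg hx).add (integrableOn_exp_neg_Ioi 0)) ?_
      intro t
      simp only [Nat.cast_one, one_mul]
      have h1 : Real.cosh t = Real.sinh t + Real.exp (-t) := by
        rw [← Real.cosh_sub_sinh]; ring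
      have h2 : Real.exp (-x * Real.cosh t) ≤ 1 := by
        rw [Real.exp_le_one_iff]
        have := Real.cosh_pos t
        nlinarith
      have h3 := Real.exp_pos (-t)
      have h4 : Real.exp (-x * Real.cosh t) * Real.cosh t =
        Real.exp (-x * Real.cosh t) * Real.sinh t + Real.exp (-x * Real.cosh t) * Real.exp (-t) := by
        nth_rewrite 2 [h1]; ring
      rw [h4]
      nlinarith
    calc x * besselK 1 x ≤ x * (_ + 1) := mul_le_mul_of_nonneg_left this hx.le
      _ = _ := by rw [mul_add, hs hx, mul_one]
  have c1 : Tendsto (fun x : ℝ => Real.exp (-x)) (nhdsWithin 0 (Set.Ioi 0)) (nhds 1) := by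
    have : Continuous (fun x : ℝ => Real.exp (-x)) := by fun_prop
    simpa using (this.tendsto 0).mono_left nhdsWithin_le_nhds
  have c2 : Tendsto (fun x : ℝ => Real.exp (-x) + x) (nhdsWithin 0 (Set.Ioi 0)) (nhds 1) := by
    have : Continuous (fun x : ℝ => Real.exp (-x) + x) := by fun_prop
    simpa using (this.tendsto 0).mono_left nhdsWithin_le_nhds
  exact tendsto_of_tendsto_of_tendsto_of_le_of_le' c1 c2 hlow hup

lemma wronskian_zero {x : ℝ} (hx : 0 < x) :
    x * (besselK 1 x * besselI 0 x + besselK 0 x * besselI 1 x) = 1 := by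
  set W : ℝ → ℝ := fun x => x * (besselK 1 x * besselI 0 x + besselK 0 x * besselI 1 x) with hW
  have hd : ∀ y ∈ Set.Ioi (0 : ℝ), HasDerivAt W 0 y := by
    intro y hy
    have hy : 0 < y := hy
    have h := (hasDerivAt_id y).mul
      (((besselK_hasDerivAt 1 hy).mul (besselI_hasDerivAt 0 hy)).add
        ((besselK_hasDerivAt 0 hy).mul (besselI_hasDerivAt 1 hy)))
    refine h.congr_deriv ?_
    have r1 := besselK_rec 0 hy
    have r2 := besselI_rec 0 hy
    simp only [zero_add, Pi.add_apply, Pi.mul_apply, id, Nat.cast_zero, Nat.cast_one,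
      Nat.reduceAdd] at r1 r2 ⊢
    rw [r1, r2]
    field_simp
    ring
  obtain ⟨c, hc⟩ := isOpen_Ioi.exists_is_const_of_deriv_eq_zero (isPreconnected_Ioi)
    (fun y hy => (hd y hy).differentiableAt.differentiableWithinAt)
    (fun y hy => (hd y hy).deriv)
  have hlim1 : Tendsto W (nhdsWithin 0 (Set.Ioi 0)) (nhds c) :=
    tendsto_const_nhds.congr' (by
      filter_upwards [self_mem_nhdsWithin] with y hy
      exact (hc y hy).symm)
  have hI0 : Tendsto (besselI 0) (nhdsWithin 0 (Set.Ioi 0)) (nhds 1) := by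
    simpa [besselI_zero_zero] using
      ((besselI_continuous 0).tendsto 0).mono_left nhdsWithin_le_nhds
  have hI1 : Tendsto (besselI 1) (nhdsWithin 0 (Set.Ioi 0)) (nhds 0) := by
    simpa [besselI_one_zero] using
      ((besselI_continuous 1).tendsto 0).mono_left nhdsWithin_le_nhds
  have hz : Tendsto (fun x => x * besselK 0 x * besselI 1 x) (nhdsWithin 0 (Set.Ioi 0))
      (nhds 0) := by
    have hu : Tendsto (fun x => x * besselK 1 x * besselI 1 x) (nhdsWithin 0 (Set.Ioi 0))
      (nhds 0) := by simpa using besselK_one_tendsto.mul hI1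
    refine tendsto_of_tendsto_of_tendsto_of_le_of_le' tendsto_const_nhds hu ?_ ?_
    · filter_upwards [self_mem_nhdsWithin] with y hy
      have hy : 0 < y := hy
      have := besselK_pos 0 hy
      have := besselI_pos 1 hy
      positivity
    · filter_upwards [self_mem_nhdsWithin] with y hy
      have hy : 0 < y := hy
      have := besselK_le_succ 0 hy
      have := besselI_pos 1 hy
      gcongr
  have hlim2 : Tendsto W (nhdsWithin 0 (Set.Ioi 0)) (nhds 1) := by
    have := (besselK_one_tendsto.mul hI0).add hz
    simp only [mul_one, add_zero] at this
    refine this.congr fun y => ?_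
    simp only [hW]; ring
  have := hc x hx
  rw [← tendsto_nhds_unique hlim1 hlim2, ← this]

lemma wronskian (k : ℕ) {x : ℝ} (hx : 0 < x) :
    x * (besselK (k + 1) x * besselI k x + besselK k x * besselI (k + 1) x) = 1 := by
  induction k with
  | zero => exact wronskian_zero hx
  | succ k ih =>
    rw [besselK_rec k hx, besselI_rec k hx, ← ih]
    ring

lemma besselKm1_pos (k : ℕ) {x : ℝ} (hx : 0 < x) : 0 < besselKm1 k x := by
  unfold besselKm1
  split_ifs <;> exact besselK_pos _ hx

lemma besselK_succ_eq (k : ℕ) {x : ℝ} (hx : 0 < x) :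
    besselK (k + 1) x = besselKm1 k x + 2 * k / x * besselK k x := by
  rcases k with _ | k
  · simp [besselKm1]
  · rw [besselK_rec k hx]; simp [besselKm1]

lemma besselI_succ_eq (k : ℕ) {x : ℝ} (hx : 0 < x) :
    besselI (k + 1) x = besselIm1 k x - 2 * k / x * besselI k x := by
  rcases k with _ | k
  · simp [besselIm1]
  · rw [besselI_rec k hx]; simp [besselIm1]

lemma prod_le (k : ℕ) {x : ℝ} (hx : 0 < x) : x * (besselK k x * besselI k x) ≤ 1 := by
  rw [← wronskian k hx]
  have h1 := besselK_le_succ k hx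
  have h2 := besselI_pos k hx
  have h3 := besselI_pos (k + 1) hx
  have h4 := besselK_pos k hx
  have : besselK k x * besselI k x ≤ besselK (k + 1) x * besselI k x := by gcongr
  have : 0 < besselK k x * besselI (k + 1) x := by positivity
  gcongr
  linarith

/-- derivatives of `I` -/
noncomputable def dI (k : ℕ) (x : ℝ) : ℝ := besselI (k + 1) x + k / x * besselI k x
/-- derivatives of `K` -/
noncomputable def dK (k : ℕ) (x : ℝ) : ℝ := -besselK (k + 1) x + k / x * besselK k x

lemma dI_hasDerivAt (k : ℕ) {x : ℝ} (hx : 0 < x) :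
    HasDerivAt (dI k) ((k ^ 2 / x ^ 2 + 1) * besselI k x - dI k x / x) x := by
  have h1 : HasDerivAt (fun x : ℝ => (k : ℝ) / x) (-k / x ^ 2) x := by
    simpa [div_eq_mul_inv] using (hasDerivAt_inv hx.ne').const_mul (k : ℝ)
  refine ((besselI_hasDerivAt (k + 1) hx).add (h1.mul (besselI_hasDerivAt k hx))).congr_deriv ?_
  rw [besselI_rec k hx]
  unfold dI
  push_cast
  field_simp
  ring

lemma dK_hasDerivAt (k : ℕ) {x : ℝ} (hx : 0 < x) :
    HasDerivAt (dK k) ((k ^ 2 / x ^ 2 + 1) * besselK k x - dK k x / x) x := by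
  have h1 : HasDerivAt (fun x : ℝ => (k : ℝ) / x) (-k / x ^ 2) x := by
    simpa [div_eq_mul_inv] using (hasDerivAt_inv hx.ne').const_mul (k : ℝ)
  refine ((besselK_hasDerivAt (k + 1) hx).neg.add
    (h1.mul (besselK_hasDerivAt k hx))).congr_deriv ?_
  rw [besselK_rec k hx]
  unfold dK
  push_cast
  field_simp
  ring

lemma hasDerivAt_intervalIntegral_aux {h : ℝ → ℂ} (hh : ContinuousOn h (Set.Ioi 0)) {r₀ r : ℝ}
    (hr₀ : 0 < r₀) (hr : 0 < r) : HasDerivAt (fun r => ∫ s in r₀..r, h s) (h r) r := by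
  refine intervalIntegral.integral_hasDerivAt_right ?_ ?_ ?_
  · refine (hh.mono ?_).intervalIntegrable
    intro s hs
    exact lt_of_lt_of_le (lt_min hr₀ hr) hs.1
  · exact hh.stronglyMeasurableAtFilter isOpen_Ioi r hr
  · exact hh.continuousAt (Ioi_mem_nhds hr)

lemma abstract_main {r₀ : ℝ} (hr₀ : 0 < r₀) (A B A1 B1 q : ℝ → ℂ)
    (hA : ∀ r : ℝ, 0 < r → HasDerivAt A (A1 r) r)
    (hB : ∀ r : ℝ, 0 < r → HasDerivAt B (B1 r) r)
    (hA1 : ∀ r : ℝ, 0 < r → HasDerivAt A1 (q r * A r - A1 r / r) r)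
    (hB1 : ∀ r : ℝ, 0 < r → HasDerivAt B1 (q r * B r - B1 r / r) r)
    (hW : ∀ r : ℝ, 0 < r → r * (A1 r * B r - A r * B1 r) = 1)
    (hq : ContinuousOn q (Set.Ioi 0))
    (f : ℝ → ℂ) (hf : ContinuousOn f (Set.Ici r₀))
    (hIntg : IntegrableOn (fun s : ℝ => f s * B s * s) (Set.Ioi r₀)) (c : ℂ) (u : ℝ → ℂ)
    (hu : ∀ r : ℝ, u r = B r * c + B r * (∫ s in r₀..r, f s * A s * s)
      + A r * (∫ s in Set.Ioi r, f s * B s * s)) :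
    ContDiffOn ℝ 2 u (Set.Ioi r₀) ∧
    (∀ r : ℝ, r₀ < r → deriv (deriv u) r + deriv u r / r - q r * u r = - f r) ∧
    HasDerivWithinAt u (B1 r₀ * c + A1 r₀ * ∫ s in Set.Ioi r₀, f s * B s * s) (Set.Ici r₀) r₀ := by
  set g : ℝ → ℂ := fun s => f (max r₀ s) with hg
  have hgc : Continuous g := by
    refine hf.comp_continuous (by fun_prop) ?_
    intro s
    exact Set.mem_Ici.2 (le_max_left r₀ s)
  have hgf : ∀ s, r₀ ≤ s → g s = f s := fun s hs => by simp only [hg, max_eq_right hs]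
  have cA : ContinuousOn A (Set.Ioi 0) := fun r hr => (hA r hr).continuousAt.continuousWithinAt
  have cB : ContinuousOn B (Set.Ioi 0) := fun r hr => (hB r hr).continuousAt.continuousWithinAt
  have cid : Continuous (fun s : ℝ => (s : ℂ)) := Complex.continuous_ofReal
  set F : ℝ → ℂ := fun r => ∫ s in r₀..r, g s * A s * s with hF
  set G : ℝ → ℂ := fun r => ∫ s in r₀..r, g s * B s * s with hG
  set J : ℂ := ∫ s in Set.Ioi r₀, f s * B s * s with hJ
  have dF : ∀ r : ℝ, 0 < r → HasDerivAt F (g r * A r * r) r := fun r hr =>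
    hasDerivAt_intervalIntegral_aux (h := fun s : ℝ => g s * A s * s)
      ((hgc.continuousOn.mul cA).mul cid.continuousOn) hr₀ hr
  have dG : ∀ r : ℝ, 0 < r → HasDerivAt G (g r * B r * r) r := fun r hr =>
    hasDerivAt_intervalIntegral_aux (h := fun s : ℝ => g s * B s * s)
      ((hgc.continuousOn.mul cB).mul cid.continuousOn) hr₀ hr
  set U : ℝ → ℂ := fun r => B r * c + B r * F r + A r * (J - G r) with hU
  set U1 : ℝ → ℂ := fun r => B1 r * c + B1 r * F r + A1 r * (J - G r) with hU1
  have huU : ∀ r, r₀ ≤ r → u r = U r := by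
    intro r hr
    have e1 : ∫ s in r₀..r, f s * A s * s = F r := by
      refine intervalIntegral.integral_congr fun s hs => ?_
      rw [uIcc_of_le hr] at hs
      simp only [hgf s hs.1]
    have e2 : ∫ s in Set.Ioi r, f s * B s * s = J - G r := by
      have e3 : ∫ s in r₀..r, f s * B s * s = G r := by
        refine intervalIntegral.integral_congr fun s hs => ?_
        rw [uIcc_of_le hr] at hs
        simp only [hgf s hs.1]
      rw [← e3, ← intervalIntegral.integral_Ioi_sub_Ioi hIntg hr]
      ring
    rw [hu, e1, e2]
  have dU : ∀ r : ℝ, 0 < r → HasDerivAt U (U1 r) r := by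
    intro r hr
    refine ((((hB r hr).mul_const c).add ((hB r hr).mul (dF r hr))).add
      ((hA r hr).mul ((dG r hr).const_sub J))).congr_deriv ?_
    simp only [hU1]
    ring
  have dU1 : ∀ r : ℝ, 0 < r → HasDerivAt U1 (q r * U r - U1 r / r - g r) r := by
    intro r hr
    refine ((((hB1 r hr).mul_const c).add ((hB1 r hr).mul (dF r hr))).add
      ((hA1 r hr).mul ((dG r hr).const_sub J))).congr_deriv ?_
    simp only [hU1, hU]
    linear_combination (-g r) * hW r hr
  have du : ∀ r, r₀ < r → HasDerivAt u (U1 r) r := fun r hr =>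
    (dU r (hr₀.trans hr)).congr_of_eventuallyEq (by
      filter_upwards [Ioi_mem_nhds hr] with s hs
      exact huU s (le_of_lt hs))
  have ddu : ∀ r, r₀ < r → HasDerivAt (deriv u) (q r * U r - U1 r / r - g r) r := fun r hr =>
    (dU1 r (hr₀.trans hr)).congr_of_eventuallyEq (by
      filter_upwards [Ioi_mem_nhds hr] with s hs
      exact (du s hs).deriv)
  refine ⟨?_, ?_, ?_⟩
  · have h2 : (2 : WithTop ℕ∞) = 1 + 1 := by norm_num
    have h1 : (1 : WithTop ℕ∞) = 0 + 1 := by norm_num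
    rw [h2, contDiffOn_succ_iff_deriv_of_isOpen isOpen_Ioi]
    refine ⟨fun r hr => (du r hr).differentiableAt.differentiableWithinAt, by simp, ?_⟩
    rw [h1, contDiffOn_succ_iff_deriv_of_isOpen isOpen_Ioi]
    refine ⟨fun r hr => (ddu r hr).differentiableAt.differentiableWithinAt, by simp, ?_⟩
    rw [contDiffOn_zero]
    have hsub : Set.Ioi r₀ ⊆ Set.Ioi 0 := Ioi_subset_Ioi hr₀.le
    have cU : ContinuousOn U (Set.Ioi 0) := fun r hr => (dU r hr).continuousAt.continuousWithinAt
    have cU1 : ContinuousOn U1 (Set.Ioi 0) :=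
      fun r hr => (dU1 r hr).continuousAt.continuousWithinAt
    have : ContinuousOn (fun r : ℝ => q r * U r - U1 r / r - g r) (Set.Ioi 0) := by
      refine ((hq.mul cU).sub (cU1.div cid.continuousOn ?_)).sub hgc.continuousOn
      intro r hr
      exact_mod_cast (ne_of_gt hr)
    exact (this.mono hsub).congr fun r hr => (ddu r hr).deriv
  · intro r hr
    rw [(ddu r hr).deriv, (du r hr).deriv, huU r hr.le, hgf r hr.le]
    ring
  · have h := (dU r₀ hr₀).hasDerivWithinAt (s := Set.Ici r₀)
    have h' := h.congr (fun s hs => huU s hs) (huU r₀ le_rfl)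
    refine h'.congr_deriv ?_
    simp [hU1, hF, hG]

lemma norm_setIntegral_aux {r₀ : ℝ} {f : ℝ → ℂ}
    (hL1 : IntegrableOn (fun s : ℝ => (Real.sqrt s : ℂ) * f s) (Set.Ioi r₀))
    {S : Set ℝ} (hS : MeasurableSet S) (hSs : S ⊆ Set.Ioi r₀) {D : ℝ} (hD : 0 ≤ D) {h : ℝ → ℂ}
    (hh : ∀ s ∈ S, ‖h s‖ ≤ D * ‖(Real.sqrt s : ℂ) * f s‖) :
    ‖∫ s in S, h s‖ ≤ D * ∫ s in Set.Ioi r₀, ‖(Real.sqrt s : ℂ) * f s‖ := by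
  have h1 : IntegrableOn (fun s => D * ‖(Real.sqrt s : ℂ) * f s‖) (Set.Ioi r₀) :=
    hL1.norm.const_mul D
  refine (norm_integral_le_of_norm_le (h1.mono_set hSs)
    ((ae_restrict_iff' hS).2 (Eventually.of_forall hh))).trans ?_
  rw [← integral_const_mul]
  exact setIntegral_mono_set h1 (Eventually.of_forall fun s => by simp only [Pi.zero_apply]; positivity)
    (Eventually.of_forall hSs)

theorem resolventSol_solves (r₀ τ : ℝ) (hr₀ : 0 < r₀) (hτ : 0 < τ) (k : ℕ)
    (f : ℝ → ℂ) (hf : ContinuousOn f (Set.Ici r₀))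
    (hL1 : IntegrableOn (fun s : ℝ => (Real.sqrt s : ℂ) * f s) (Set.Ioi r₀)) :
    ContDiffOn ℝ 2 (resolventSol r₀ τ k f) (Set.Ioi r₀) ∧
    (∀ r : ℝ, r₀ < r →
      deriv (deriv (resolventSol r₀ τ k f)) r
          + deriv (resolventSol r₀ τ k f) r / (r : ℂ)
          - (((k : ℂ) ^ 2 / (r : ℂ) ^ 2) + (τ : ℂ)) * resolventSol r₀ τ k f r
        = -f r) ∧
    ((r₀ : ℂ) * derivWithin (resolventSol r₀ τ k f) (Set.Ici r₀) r₀
        + (k : ℂ) * resolventSol r₀ τ k f r₀ = 0) ∧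
    Tendsto (resolventSol r₀ τ k f) atTop (nhds 0) := by
  obtain ⟨a, ha⟩ : ∃ a, a = Real.sqrt τ := ⟨_, rfl⟩
  have ha0 : 0 < a := ha ▸ Real.sqrt_pos.2 hτ
  have ha2 : a ^ 2 = τ := by rw [ha]; exact Real.sq_sqrt hτ.le
  -- scaled functions
  obtain ⟨A, hAdef⟩ : ∃ A : ℝ → ℝ, A = fun r => besselI k (a * r) := ⟨_, rfl⟩
  obtain ⟨B, hBdef⟩ : ∃ B : ℝ → ℝ, B = fun r => besselK k (a * r) := ⟨_, rfl⟩
  obtain ⟨A1, hA1def⟩ : ∃ A : ℝ → ℝ, A = fun r => a * dI k (a * r) := ⟨_, rfl⟩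
  obtain ⟨B1, hB1def⟩ : ∃ B : ℝ → ℝ, B = fun r => a * dK k (a * r) := ⟨_, rfl⟩
  have hlin : ∀ r : ℝ, HasDerivAt (fun r : ℝ => a * r) a r := fun r => by
    simpa using (hasDerivAt_id r).const_mul a
  have dA : ∀ r, 0 < r → HasDerivAt A (A1 r) r := by
    intro r hr
    have hx : 0 < a * r := by positivity
    rw [hAdef]
    refine ((besselI_hasDerivAt k hx).comp r (hlin r)).congr_deriv ?_
    rw [hA1def]; unfold dI; ring
  have dB : ∀ r, 0 < r → HasDerivAt B (B1 r) r := by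
    intro r hr
    have hx : 0 < a * r := by positivity
    rw [hBdef]
    refine ((besselK_hasDerivAt k hx).comp r (hlin r)).congr_deriv ?_
    rw [hB1def]; unfold dK; ring
  have dA1 : ∀ r, 0 < r → HasDerivAt A1 ((k ^ 2 / r ^ 2 + τ) * A r - A1 r / r) r := by
    intro r hr
    have hx : 0 < a * r := by positivity
    rw [hA1def]
    refine (((dI_hasDerivAt k hx).comp r (hlin r)).const_mul a).congr_deriv ?_
    simp only [hAdef]
    rw [← ha2]
    field_simp
  have dB1 : ∀ r, 0 < r → HasDerivAt B1 ((k ^ 2 / r ^ 2 + τ) * B r - B1 r / r) r := by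
    intro r hr
    have hx : 0 < a * r := by positivity
    rw [hB1def]
    refine (((dK_hasDerivAt k hx).comp r (hlin r)).const_mul a).congr_deriv ?_
    simp only [hBdef]
    rw [← ha2]
    field_simp
  have hW : ∀ r, 0 < r → r * (A1 r * B r - A r * B1 r) = 1 := by
    intro r hr
    have hx : 0 < a * r := by positivity
    rw [← wronskian k hx]
    simp only [hA1def, hB1def, hAdef, hBdef]
    unfold dI dK
    ring
  have pA : ∀ r, 0 < r → 0 < A r := fun r hr => by
    rw [hAdef]; exact besselI_pos k (by positivity)
  have pB : ∀ r, 0 < r → 0 < B r := fun r hr => by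
    rw [hBdef]; exact besselK_pos k (by positivity)
  have mA : ∀ s r, 0 < s → s ≤ r → A s ≤ A r := fun s r hs hsr => by
    rw [hAdef]; exact besselI_mono k (by positivity) (by gcongr)
  have hAB : ∀ r, 0 < r → r * (B r * A r) ≤ 1 / a := fun r hr => by
    have := prod_le k (x := a * r) (by positivity)
    rw [le_div_iff₀ ha0, hAdef, hBdef]
    linarith
  have hABs : ∀ r, 0 < r → Real.sqrt r * (B r * A r) ≤ 1 / a / Real.sqrt r := fun r hr => by
    rw [le_div_iff₀ (Real.sqrt_pos.2 hr)]
    calc _ = (Real.sqrt r * Real.sqrt r) * (B r * A r) := by ring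
      _ ≤ _ := by rw [Real.mul_self_sqrt hr.le]; exact hAB r hr
  have hABs2 : ∀ s r, 0 < s → s ≤ r → Real.sqrt s * (B r * A s) ≤ 1 / a / Real.sqrt r := by
    intro s r hs hsr
    refine le_trans ?_ (hABs r (hs.trans_le hsr))
    have := pB r (hs.trans_le hsr)
    have := pA s hs
    have := mA s r hs hsr
    gcongr
  have hABs3 : ∀ r s, 0 < r → r ≤ s → Real.sqrt s * (B s * A r) ≤ 1 / a / Real.sqrt r := by
    intro r s hr hrs
    have hs := hr.trans_le hrs
    have h1 := pB s hs
    have h2 := pA r hr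
    have h3 := mA r s hr hrs
    have h4 := Real.sqrt_pos.2 hr
    calc Real.sqrt s * (B s * A r) ≤ Real.sqrt s * (B s * A s) := by gcongr
      _ ≤ 1 / a / Real.sqrt s := hABs s hs
      _ ≤ _ := by gcongr
  have cB : ContinuousOn B (Set.Ioi 0) := fun r hr => (dB r hr).continuousAt.continuousWithinAt
  have hsq : ∀ s : ℝ, 0 < s → Real.sqrt s * Real.sqrt s = s := fun s hs => Real.mul_self_sqrt hs.le
  -- integrability
  have hIntg : IntegrableOn (fun s : ℝ => f s * (B s : ℂ) * s) (Set.Ioi r₀) := by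
    refine Integrable.mono' (hL1.norm.const_mul (1 / a / Real.sqrt r₀ / A r₀)) ?_ ?_
    · refine ContinuousOn.aestronglyMeasurable ?_ measurableSet_Ioi
      refine ((hf.mono Ioi_subset_Ici_self).mul ?_).mul Complex.continuous_ofReal.continuousOn
      exact Complex.continuous_ofReal.comp_continuousOn (cB.mono (Ioi_subset_Ioi hr₀.le))
    · refine (ae_restrict_iff' measurableSet_Ioi).2 (Eventually.of_forall fun s hs => ?_)
      have hs : r₀ < s := hs
      have hs0 := hr₀.trans hs
      have h := hABs3 r₀ s hr₀ hs.le
      have h0 := pA r₀ hr₀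
      have h' : Real.sqrt s * B s ≤ 1 / a / Real.sqrt r₀ / A r₀ := by
        rw [le_div_iff₀ h0]; linarith
      simp only [norm_mul, Complex.norm_real, Real.norm_eq_abs]
      rw [abs_of_pos (pB s hs0), abs_of_pos hs0, abs_of_pos (Real.sqrt_pos.2 hs0)]
      calc ‖f s‖ * B s * s = (Real.sqrt s * B s) * (Real.sqrt s * ‖f s‖) := by
            linear_combination (-(‖f s‖ * B s)) * hsq s hs0
        _ ≤ _ := by gcongr
  obtain ⟨J, hJ⟩ : ∃ J, J = ∫ s in Set.Ioi r₀, f s * (B s : ℂ) * (s : ℂ) := ⟨_, rfl⟩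
  obtain ⟨c, hc⟩ : ∃ c : ℂ, c = (besselIm1 k (a * r₀) : ℂ) / (besselKm1 k (a * r₀) : ℂ) * J :=
    ⟨_, rfl⟩
  have hu : ∀ r : ℝ, resolventSol r₀ τ k f r = (B r : ℂ) * c
      + (B r : ℂ) * (∫ s in r₀..r, f s * (A s : ℂ) * s)
      + (A r : ℂ) * (∫ s in Set.Ioi r, f s * (B s : ℂ) * s) := by
    intro r
    unfold resolventSol
    rw [hc, hJ, hAdef, hBdef, ← ha]
    ring
  have hq : ContinuousOn (fun r : ℝ => (k : ℂ) ^ 2 / (r : ℂ) ^ 2 + (τ : ℂ)) (Set.Ioi 0) := by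
    refine (continuousOn_const.div (Complex.continuous_ofReal.continuousOn.pow 2) ?_).add
      continuousOn_const
    intro r hr
    have : (r : ℂ) ≠ 0 := by exact_mod_cast (ne_of_gt hr)
    exact pow_ne_zero 2 this
  have main := abstract_main hr₀ (fun r => (A r : ℂ)) (fun r => (B r : ℂ)) (fun r => (A1 r : ℂ))
    (fun r => (B1 r : ℂ)) (fun r : ℝ => (k : ℂ) ^ 2 / (r : ℂ) ^ 2 + (τ : ℂ))
    (fun r hr => (dA r hr).ofReal_comp) (fun r hr => (dB r hr).ofReal_comp)
    (fun r hr => by simpa using (dA1 r hr).ofReal_comp)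
    (fun r hr => by simpa using (dB1 r hr).ofReal_comp)
    (fun r hr => by exact_mod_cast hW r hr) hq f hf hIntg c (resolventSol r₀ τ k f) hu
  obtain ⟨m1, m2, m3⟩ := main
  refine ⟨m1, m2, ?_, ?_⟩
  · rw [m3.derivWithin (uniqueDiffOn_Ici r₀ r₀ self_mem_Ici), hu r₀, ← hJ]
    simp only [intervalIntegral.integral_same, mul_zero, add_zero]
    have hx : 0 < a * r₀ := by positivity
    have hKne : (besselKm1 k (a * r₀) : ℂ) ≠ 0 := by
      exact_mod_cast (besselKm1_pos k hx).ne'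
    have eA : r₀ * A1 r₀ + k * A r₀ = a * r₀ * besselIm1 k (a * r₀) := by
      rw [hA1def, hAdef]
      simp only [dI]
      rw [besselI_succ_eq k hx]
      field_simp
      ring
    have eB : r₀ * B1 r₀ + k * B r₀ = -(a * r₀ * besselKm1 k (a * r₀)) := by
      rw [hB1def, hBdef]
      simp only [dK]
      rw [besselK_succ_eq k hx]
      field_simp
      ring
    have eA' : (r₀ : ℂ) * A1 r₀ + k * A r₀ = a * r₀ * besselIm1 k (a * r₀) := by exact_mod_cast eA
    have eB' : (r₀ : ℂ) * B1 r₀ + k * B r₀ = -(a * r₀ * besselKm1 k (a * r₀)) := by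
      exact_mod_cast eB
    have hcK : (besselKm1 k (a * r₀) : ℂ) * c = besselIm1 k (a * r₀) * J := by
      rw [hc]; field_simp
    linear_combination c * eB' + J * eA' - a * r₀ * hcK
  · obtain ⟨N, hN⟩ : ∃ N, N = ∫ s in Set.Ioi r₀, ‖(Real.sqrt s : ℂ) * f s‖ := ⟨_, rfl⟩
    have hsqrt : Tendsto (fun r : ℝ => 1 / a / Real.sqrt r) atTop (nhds 0) :=
      tendsto_const_nhds.div_atTop Real.tendsto_sqrt_atTop
    have hB0 : Tendsto B atTop (nhds 0) := by
      have hz : Tendsto (fun r : ℝ => 1 / a / Real.sqrt r / (Real.sqrt r₀ * A r₀)) atTop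
          (nhds 0) := by simpa using hsqrt.div_const (Real.sqrt r₀ * A r₀)
      refine tendsto_of_tendsto_of_tendsto_of_le_of_le' tendsto_const_nhds hz ?_ ?_
      · filter_upwards [eventually_gt_atTop 0] with r hr
        exact (pB r hr).le
      · filter_upwards [eventually_ge_atTop r₀] with r hr
        have h1 := pA r₀ hr₀
        have h2 := Real.sqrt_pos.2 hr₀
        rw [le_div_iff₀ (by positivity)]
        have := hABs2 r₀ r hr₀ hr
        linarith
    have t1 : Tendsto (fun r => (B r : ℂ) * c) atTop (nhds 0) := by
      have := (Complex.continuous_ofReal.tendsto 0).comp hB0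
      simpa using this.mul_const c
    have hDN : Tendsto (fun r : ℝ => 1 / a / Real.sqrt r * N) atTop (nhds 0) := by
      simpa using hsqrt.mul_const N
    have t2 : Tendsto (fun r => (B r : ℂ) * (∫ s in r₀..r, f s * (A s : ℂ) * s)) atTop
        (nhds 0) := by
      refine squeeze_zero_norm' ?_ hDN
      filter_upwards [eventually_ge_atTop r₀] with r hr
      have hr0 := hr₀.trans_le hr
      rw [intervalIntegral.integral_of_le hr, ← integral_const_mul, hN]
      refine norm_setIntegral_aux hL1 measurableSet_Ioc Ioc_subset_Ioi_self (by positivity) ?_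
      intro s hs
      have hs0 := hr₀.trans hs.1
      simp only [norm_mul, Complex.norm_real, Real.norm_eq_abs]
      rw [abs_of_pos (pB r hr0), abs_of_pos (pA s hs0), abs_of_pos hs0,
        abs_of_pos (Real.sqrt_pos.2 hs0)]
      have := hABs2 s r hs0 hs.2
      calc B r * (‖f s‖ * A s * s)
          = (Real.sqrt s * (B r * A s)) * (Real.sqrt s * ‖f s‖) := by
            linear_combination (-(B r * ‖f s‖ * A s)) * hsq s hs0
        _ ≤ _ := by gcongr
    have t3 : Tendsto (fun r => (A r : ℂ) * (∫ s in Set.Ioi r, f s * (B s : ℂ) * s)) atTop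
        (nhds 0) := by
      refine squeeze_zero_norm' ?_ hDN
      filter_upwards [eventually_ge_atTop r₀] with r hr
      have hr0 := hr₀.trans_le hr
      rw [← integral_const_mul, hN]
      refine norm_setIntegral_aux hL1 measurableSet_Ioi (Ioi_subset_Ioi hr) (by positivity) ?_
      intro s hs
      have hs : r < s := hs
      have hs0 := hr0.trans hs
      simp only [norm_mul, Complex.norm_real, Real.norm_eq_abs]
      rw [abs_of_pos (pA r hr0), abs_of_pos (pB s hs0), abs_of_pos hs0,
        abs_of_pos (Real.sqrt_pos.2 hs0)]
      have := hABs3 r s hr0 hs.le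
      calc A r * (‖f s‖ * B s * s)
          = (Real.sqrt s * (B s * A r)) * (Real.sqrt s * ‖f s‖) := by
            linear_combination (-(A r * ‖f s‖ * B s)) * hsq s hs0
        _ ≤ _ := by gcongr
    have := (t1.add t2).add t3
    simp only [add_zero] at this
    exact this.congr fun r => (hu r).symm
end

section
/- (Residue of the boundary-correction term, k ≥ 2.) Fix r_0 > 0, an integer k ≥ 2, and r ≥ r_0. Let f : (r_0, ∞) → ℂ be measurable with √s·f(s) ∈ L¹(r_0, ∞). For τ > 0 define G(τ) = (K_k(√τ·r)·I_{k−1}(√τ·r_0)/K_{k−1}(√τ·r_0))·∫_{r_0}^∞ f(s)·K_k(√τ·s)·s ds. Then lim_{τ→0+} τ·G(τ) = (2·(k−1)·r_0^{2k−2}/r^k)·∫_{r_0}^∞ s^{−k+1}·f(s) ds. -/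
open Complex Set Filter MeasureTheory

/-- The boundary-correction term `G(τ)` of the resolvent. -/
noncomputable def correctionTerm (r₀ : ℝ) (k : ℕ) (f : ℝ → ℂ) (r τ : ℝ) : ℂ :=
  ((besselK k (Real.sqrt τ * r) : ℂ) * (besselI (k - 1) (Real.sqrt τ * r₀) : ℂ)
      / (besselK (k - 1) (Real.sqrt τ * r₀) : ℂ)) *
    ∫ s in Set.Ioi r₀, f s * (besselK k (Real.sqrt τ * s) : ℂ) * (s : ℂ)

theorem aux_gamma_int (n : ℕ) :
    IntegrableOn (fun u : ℝ => u ^ n * Real.exp (-u)) (Ioi 0) := by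
  have h := Real.GammaIntegral_convergent (s := (n : ℝ) + 1) (by positivity)
  refine h.congr_fun (fun u hu => ?_) measurableSet_Ioi
  simp only [add_sub_cancel_right, Real.rpow_natCast]
  ring

theorem aux_gamma_val (n : ℕ) :
    ∫ u in Ioi (0 : ℝ), u ^ n * Real.exp (-u) = (n.factorial : ℝ) := by
  rw [← Real.Gamma_nat_eq_factorial, Real.Gamma_eq_integral (by positivity)]
  refine setIntegral_congr_fun measurableSet_Ioi (fun u hu => ?_)
  simp only [add_sub_cancel_right, Real.rpow_natCast]
  ring

/-- The regularised integral. -/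
noncomputable def auxA (n : ℕ) (x : ℝ) : ℝ :=
  ∫ u in Ioi (0 : ℝ), u ^ n * Real.exp (-u) * Real.exp (-(x ^ 2 / (4 * u)))

theorem aux_meas (n : ℕ) :
    Measurable (fun p : ℝ × ℝ => p.2 ^ n * Real.exp (-p.2) * Real.exp (-(p.1 ^ 2 / (4 * p.2)))) := by
  fun_prop

theorem aux_bound (n : ℕ) (x u : ℝ) (hu : 0 < u) :
    ‖u ^ n * Real.exp (-u) * Real.exp (-(x ^ 2 / (4 * u)))‖ ≤ u ^ n * Real.exp (-u) := by
  have h1 : Real.exp (-(x ^ 2 / (4 * u))) ≤ 1 := by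
    rw [Real.exp_le_one_iff]
    have : 0 ≤ x ^ 2 / (4 * u) := by positivity
    linarith
  rw [Real.norm_of_nonneg (by positivity)]
  exact mul_le_of_le_one_right (by positivity) h1

theorem aux_int (n : ℕ) (x : ℝ) :
    IntegrableOn (fun u : ℝ => u ^ n * Real.exp (-u) * Real.exp (-(x ^ 2 / (4 * u)))) (Ioi 0) := by
  refine Integrable.mono' (aux_gamma_int n) ?_ ?_
  · exact ((aux_meas n).comp (measurable_const.prodMk measurable_id)).aestronglyMeasurable
  · filter_upwards [ae_restrict_mem measurableSet_Ioi] with u hu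
    exact aux_bound n x u hu

theorem auxA_measurable (n : ℕ) : Measurable (auxA n) :=
  ((aux_meas n).stronglyMeasurable.integral_prod_right' (ν := volume.restrict (Ioi 0))).measurable

theorem auxA_bound (n : ℕ) (x : ℝ) : ‖auxA n x‖ ≤ n.factorial := by
  rw [← aux_gamma_val]
  refine norm_integral_le_of_norm_le (aux_gamma_int n) ?_
  filter_upwards [ae_restrict_mem measurableSet_Ioi] with u hu
  exact aux_bound n x u hu

theorem auxA_tendsto (n : ℕ) : Tendsto (auxA n) (nhds 0) (nhds (n.factorial : ℝ)) := by
  rw [← aux_gamma_val]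
  refine tendsto_integral_filter_of_dominated_convergence
    (fun u : ℝ => u ^ n * Real.exp (-u)) ?_ ?_ (aux_gamma_int n) ?_
  · exact Eventually.of_forall fun x =>
      ((aux_meas n).comp (measurable_const.prodMk measurable_id)).aestronglyMeasurable
  · refine Eventually.of_forall fun x => ?_
    filter_upwards [ae_restrict_mem measurableSet_Ioi] with u hu
    exact aux_bound n x u hu
  · refine Eventually.of_forall fun u => ?_
    have : Continuous fun x : ℝ => u ^ n * Real.exp (-u) * Real.exp (-(x ^ 2 / (4 * u))) := by
      fun_prop
    simpa using this.tendsto 0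

theorem aux_image (x : ℝ) (hx : 0 < x) :
    (fun t : ℝ => x / 2 * Real.exp t) '' univ = Ioi 0 := by
  ext u
  simp only [image_univ, mem_range, mem_Ioi]
  constructor
  · rintro ⟨t, rfl⟩; positivity
  · intro hu
    refine ⟨Real.log (2 * u / x), ?_⟩
    rw [Real.exp_log (by positivity)]
    field_simp

theorem aux_pt (n : ℕ) (x : ℝ) (hx : 0 < x) (t : ℝ) :
    |x / 2 * Real.exp t| • ((x / 2 * Real.exp t) ^ n * Real.exp (-(x / 2 * Real.exp t)) *
      Real.exp (-(x ^ 2 / (4 * (x / 2 * Real.exp t))))) =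
    (x / 2) ^ (n + 1) * (Real.exp (-x * Real.cosh t) * Real.exp (((n + 1 : ℕ) : ℝ) * t)) := by
  rw [abs_of_pos (by positivity), smul_eq_mul, Real.exp_nat_mul, mul_assoc _ (Real.exp _) (Real.exp _),
    ← Real.exp_add]
  have : -(x / 2 * Real.exp t) + -(x ^ 2 / (4 * (x / 2 * Real.exp t))) = -x * Real.cosh t := by
    rw [Real.cosh_eq, Real.exp_neg]
    field_simp
    ring
  rw [this, mul_pow, pow_succ, pow_succ]
  ring

theorem aux_K (n : ℕ) (x : ℝ) (hx : 0 < x) :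
    x ^ (n + 1) * besselK (n + 1) x = 2 ^ n * auxA n x := by
  have hd : ∀ t ∈ (univ : Set ℝ), HasDerivWithinAt (fun t : ℝ => x / 2 * Real.exp t)
      (x / 2 * Real.exp t) univ t := fun t _ =>
    ((Real.hasDerivAt_exp t).const_mul (x / 2)).hasDerivWithinAt
  have hinj : InjOn (fun t : ℝ => x / 2 * Real.exp t) univ := by
    intro a _ b _ h
    have h' : x / 2 * Real.exp a = x / 2 * Real.exp b := h
    exact Real.exp_injective (mul_left_cancel₀ (by positivity) h')
  have hint := (integrableOn_image_iff_integrableOn_abs_deriv_smul MeasurableSet.univ hd hinj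
    (fun u : ℝ => u ^ n * Real.exp (-u) * Real.exp (-(x ^ 2 / (4 * u))))).1
      (by rw [aux_image x hx]; exact aux_int n x)
  have hval := integral_image_eq_integral_abs_deriv_smul MeasurableSet.univ hd hinj
    (fun u : ℝ => u ^ n * Real.exp (-u) * Real.exp (-(x ^ 2 / (4 * u))))
  rw [aux_image x hx] at hval
  simp only [aux_pt n x hx, integrableOn_univ, setIntegral_univ] at hint hval
  change auxA n x = _ at hval
  rw [integral_const_mul] at hval
  have hg : Integrable (fun t : ℝ => Real.exp (-x * Real.cosh t) *
      Real.exp (((n + 1 : ℕ) : ℝ) * t)) := by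
    have := hint.const_mul (((x / 2) ^ (n + 1))⁻¹)
    refine this.congr (Eventually.of_forall fun t => ?_)
    have : (x / 2) ^ (n + 1) ≠ 0 := by positivity
    simp only
    rw [← mul_assoc, inv_mul_cancel₀ this, one_mul]
  have habs := integral_comp_abs (f := fun t : ℝ => Real.exp (-x * Real.cosh t) *
      Real.cosh (((n + 1 : ℕ) : ℝ) * t))
  have hpos : ∀ t : ℝ, Real.exp (-x * Real.cosh |t|) * Real.cosh (((n + 1 : ℕ) : ℝ) * |t|)
      = (1 / 2) * (Real.exp (-x * Real.cosh t) * Real.exp (((n + 1 : ℕ) : ℝ) * t)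
        + Real.exp (-x * Real.cosh (-t)) * Real.exp (((n + 1 : ℕ) : ℝ) * (-t))) := by
    intro t
    have h1 : Real.cosh (((n + 1 : ℕ) : ℝ) * |t|) = Real.cosh (((n + 1 : ℕ) : ℝ) * t) := by
      rw [← Real.cosh_abs (((n + 1 : ℕ) : ℝ) * t), abs_mul, Nat.abs_cast]
    rw [h1, Real.cosh_abs, Real.cosh_neg, Real.cosh_eq (((n + 1 : ℕ) : ℝ) * t), mul_neg]
    ring
  simp only [hpos] at habs
  rw [integral_const_mul, integral_add hg hg.comp_neg,
    integral_neg_eq_self (fun t : ℝ => Real.exp (-x * Real.cosh t) *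
      Real.exp (((n + 1 : ℕ) : ℝ) * t)) volume] at habs
  change _ = 2 * besselK (n + 1) x at habs
  rw [hval]
  have : besselK (n + 1) x = 1 / 2 * ∫ t : ℝ, Real.exp (-x * Real.cosh t) *
      Real.exp (((n + 1 : ℕ) : ℝ) * t) := by linarith
  rw [this, div_pow, pow_succ 2 n]
  field_simp

/-- The regularised power series of `I_k`. -/
noncomputable def auxJ (k : ℕ) (x : ℝ) : ℝ :=
  ∑' m : ℕ, (x / 2) ^ (2 * m) / (Nat.factorial m * Nat.factorial (m + k))

theorem aux_I (k : ℕ) (x : ℝ) : besselI k x = (x / 2) ^ k * auxJ k x := by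
  rw [besselI, auxJ, ← tsum_mul_left]
  congr 1
  ext m
  rw [pow_add]
  ring

theorem auxJ_tendsto (k : ℕ) : Tendsto (auxJ k) (nhds 0) (nhds (1 / (k.factorial : ℝ))) := by
  have h0 : (1 / (k.factorial : ℝ)) =
      ∑' m : ℕ, ((0 : ℝ) / 2) ^ (2 * m) / (Nat.factorial m * Nat.factorial (m + k)) := by
    rw [tsum_eq_single 0]
    · simp
    · intro m hm
      have : 2 * m ≠ 0 := by omega
      simp [this]
  rw [h0]
  refine tendsto_tsum_of_dominated_convergence
    (bound := fun m : ℕ => (1 : ℝ) ^ m / m.factorial) (Real.summable_pow_div_factorial 1) ?_ ?_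
  · intro m
    have : Continuous fun x : ℝ =>
      (x / 2) ^ (2 * m) / ((Nat.factorial m : ℝ) * (Nat.factorial (m + k) : ℝ)) := by fun_prop
    exact this.tendsto 0
  · have : ∀ᶠ x : ℝ in nhds 0, |x| < 2 := by
      have : Continuous fun x : ℝ => |x| := continuous_abs
      exact (this.tendsto 0).eventually_lt_const (by simp)
    filter_upwards [this] with x hx m
    rw [norm_div, norm_pow, Real.norm_of_nonneg (by positivity :
      (0 : ℝ) ≤ (Nat.factorial m : ℝ) * (Nat.factorial (m + k) : ℝ)), one_pow]
    have h1 : ‖x / 2‖ ≤ 1 := by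
      rw [Real.norm_eq_abs, abs_div, abs_two]; linarith
    have h2 : (1 : ℝ) ≤ (Nat.factorial (m + k) : ℝ) := by
      exact_mod_cast Nat.one_le_iff_ne_zero.2 (Nat.factorial_ne_zero _)
    have h3 : (0 : ℝ) < (Nat.factorial m : ℝ) := by positivity
    refine div_le_div₀ zero_le_one (pow_le_one₀ (norm_nonneg _) h1) h3 ?_
    exact le_mul_of_one_le_right h3.le h2

theorem aux_intf (r₀ : ℝ) (hr₀ : 0 < r₀) (n : ℕ) (f : ℝ → ℂ)
    (hL1 : IntegrableOn (fun s : ℝ => (Real.sqrt s : ℂ) * f s) (Set.Ioi r₀)) :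
    IntegrableOn (fun s : ℝ => ((s ^ (n + 1))⁻¹ : ℂ) * f s) (Ioi r₀) := by
  have h := Integrable.bdd_mul (f := fun s : ℝ => (((s ^ (n + 1) * Real.sqrt s)⁻¹ : ℝ) : ℂ))
    (c := (r₀ ^ (n + 1) * Real.sqrt r₀)⁻¹) hL1 ?_ ?_
  · refine IntegrableOn.congr_fun h (fun s hs => ?_) measurableSet_Ioi
    have hs0 : 0 < s := hr₀.trans hs
    have : (Real.sqrt s : ℂ) ≠ 0 := by
      exact_mod_cast (Real.sqrt_pos.2 hs0).ne'
    push_cast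
    rw [mul_inv, mul_assoc, inv_mul_cancel_left₀ this]
  · have : Measurable (fun s : ℝ => (((s ^ (n + 1) * Real.sqrt s)⁻¹ : ℝ) : ℂ)) := by fun_prop
    exact this.aestronglyMeasurable
  · filter_upwards [ae_restrict_mem measurableSet_Ioi] with s hs
    have hs0 : 0 < s := hr₀.trans hs
    have hs' : r₀ ≤ s := le_of_lt hs
    rw [Complex.norm_real, Real.norm_of_nonneg (by positivity)]
    have := Real.sqrt_pos.2 hr₀
    gcongr

theorem aux_integral_tendsto (r₀ : ℝ) (hr₀ : 0 < r₀) (n N : ℕ) (f : ℝ → ℂ)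
    (hL1 : IntegrableOn (fun s : ℝ => (Real.sqrt s : ℂ) * f s) (Set.Ioi r₀)) :
    Tendsto (fun y : ℝ => ∫ s in Ioi r₀, (auxA N (y * s) : ℂ) * (((s ^ (n + 1))⁻¹ : ℂ) * f s))
      (nhdsWithin 0 (Ioi 0))
      (nhds ((N.factorial : ℂ) * ∫ s in Ioi r₀, ((s ^ (n + 1))⁻¹ : ℂ) * f s)) := by
  have hi := aux_intf r₀ hr₀ n f hL1
  rw [← integral_const_mul]
  refine tendsto_integral_filter_of_dominated_convergence
    (fun s : ℝ => (N.factorial : ℝ) * ‖((s ^ (n + 1))⁻¹ : ℂ) * f s‖) ?_ ?_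
      (hi.norm.const_mul _) ?_
  · refine Eventually.of_forall fun y => ?_
    refine AEStronglyMeasurable.mul ?_ hi.aestronglyMeasurable
    have : Measurable (fun s : ℝ => (auxA N (y * s) : ℂ)) :=
      Complex.measurable_ofReal.comp ((auxA_measurable N).comp (measurable_const_mul y))
    exact this.aestronglyMeasurable
  · refine Eventually.of_forall fun y => Eventually.of_forall fun s => ?_
    rw [norm_mul, Complex.norm_real]
    exact mul_le_mul_of_nonneg_right (auxA_bound N _) (norm_nonneg _)
  · refine Eventually.of_forall fun s => Tendsto.mul_const _ ?_
    have h1 : Tendsto (fun y : ℝ => y * s) (nhdsWithin 0 (Ioi 0)) (nhds 0) := by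
      have : Continuous fun y : ℝ => y * s := by fun_prop
      simpa using (this.tendsto 0).mono_left nhdsWithin_le_nhds
    have h2 := ((Complex.continuous_ofReal.tendsto _).comp (auxA_tendsto N)).comp h1
    rw [Complex.ofReal_natCast] at h2
    exact h2

theorem aux_main_eq (r₀ : ℝ) (hr₀ : 0 < r₀) (n : ℕ) (r : ℝ) (hr : r₀ ≤ r) (f : ℝ → ℂ)
    (y : ℝ) (hy : 0 < y) :
    ((y ^ 2 : ℝ) : ℂ) * correctionTerm r₀ (n + 2) f r (y ^ 2) =
      2 * (((auxA (n + 1) (y * r) * auxJ (n + 1) (y * r₀) / auxA n (y * r₀) : ℝ) : ℂ) *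
        ((r₀ : ℂ) ^ (2 * n + 2) / (r : ℂ) ^ (n + 2))) *
      ∫ s in Ioi r₀, (auxA (n + 1) (y * s) : ℂ) * (((s ^ (n + 1))⁻¹ : ℂ) * f s) := by
  have hrp : 0 < r := hr₀.trans_le hr
  have hK : ∀ (m : ℕ) (x : ℝ), 0 < x →
      besselK (m + 1) x = 2 ^ m * auxA m x / x ^ (m + 1) := by
    intro m x hx
    rw [← aux_K m x hx]
    field_simp
  have hyc : (y : ℂ) ≠ 0 := by exact_mod_cast hy.ne'
  have hrc : (r : ℂ) ≠ 0 := by exact_mod_cast hrp.ne'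
  have hr₀c : (r₀ : ℂ) ≠ 0 := by exact_mod_cast hr₀.ne'
  have hI : ∫ s in Set.Ioi r₀, f s * (besselK (n + 2) (y * s) : ℂ) * (s : ℂ) =
      ((2 : ℂ) ^ (n + 1) / (y : ℂ) ^ (n + 2)) *
      ∫ s in Ioi r₀, (auxA (n + 1) (y * s) : ℂ) * (((s ^ (n + 1))⁻¹ : ℂ) * f s) := by
    rw [← integral_const_mul]
    refine setIntegral_congr_fun measurableSet_Ioi fun s hs => ?_
    have hs0 : 0 < s := hr₀.trans hs
    have hsc : (s : ℂ) ≠ 0 := by exact_mod_cast hs0.ne'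
    rw [hK (n + 1) (y * s) (by positivity)]
    push_cast
    rw [mul_pow, pow_succ (s : ℂ) (n + 1)]
    field_simp
  rw [correctionTerm, Real.sqrt_sq hy.le, hI, show n + 2 - 1 = n + 1 by omega,
    hK (n + 1) (y * r) (by positivity), hK n (y * r₀) (by positivity), aux_I]
  generalize (∫ s in Ioi r₀, (auxA (n + 1) (y * s) : ℂ) * (((s ^ (n + 1))⁻¹ : ℂ) * f s)) = Z
  push_cast
  by_cases hA : (auxA n (y * r₀) : ℂ) = 0
  · simp [hA]
  rw [div_pow]
  field_simp
  ring

theorem residue_correctionTerm_ge_two (r₀ : ℝ) (hr₀ : 0 < r₀) (k : ℕ) (hk : 2 ≤ k)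
    (r : ℝ) (hr : r₀ ≤ r) (f : ℝ → ℂ)
    (hL1 : IntegrableOn (fun s : ℝ => (Real.sqrt s : ℂ) * f s) (Set.Ioi r₀)) :
    Tendsto (fun τ : ℝ => (τ : ℂ) * correctionTerm r₀ k f r τ)
      (nhdsWithin 0 (Set.Ioi 0))
      (nhds ((2 * ((k : ℂ) - 1) * (r₀ : ℂ) ^ (2 * k - 2) / (r : ℂ) ^ k) *
        ∫ s in Set.Ioi r₀, (s : ℂ) ^ (1 - (k : ℤ)) * f s)) := by
  obtain ⟨n, rfl⟩ : ∃ n, k = n + 2 := ⟨k - 2, by omega⟩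
  have hlin : ∀ c : ℝ, Tendsto (fun y : ℝ => y * c) (nhdsWithin 0 (Ioi 0)) (nhds 0) := by
    intro c
    have : Continuous fun y : ℝ => y * c := by fun_prop
    simpa using (this.tendsto 0).mono_left nhdsWithin_le_nhds
  have hreal := (((auxA_tendsto (n + 1)).comp (hlin r)).mul
    ((auxJ_tendsto (n + 1)).comp (hlin r₀))).div ((auxA_tendsto n).comp (hlin r₀))
      (by positivity)
  have hc := (Complex.continuous_ofReal.tendsto _).comp hreal
  have hall := ((hc.mul_const ((r₀ : ℂ) ^ (2 * n + 2) / (r : ℂ) ^ (n + 2))).const_mul 2).mul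
    (aux_integral_tendsto r₀ hr₀ n (n + 1) f hL1)
  have hsq : Tendsto Real.sqrt (nhdsWithin 0 (Ioi 0)) (nhdsWithin 0 (Ioi 0)) := by
    refine tendsto_nhdsWithin_iff.2 ⟨?_, ?_⟩
    · simpa using (Real.continuous_sqrt.tendsto 0).mono_left nhdsWithin_le_nhds
    · filter_upwards [self_mem_nhdsWithin] with t ht
      exact Real.sqrt_pos.2 ht
  have hfin := hall.comp hsq
  refine Tendsto.congr' ?_ (hfin.trans (le_of_eq ?_))
  · filter_upwards [self_mem_nhdsWithin] with t ht
    have := aux_main_eq r₀ hr₀ n r hr f (Real.sqrt t) (Real.sqrt_pos.2 ht)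
    rw [Real.sq_sqrt (le_of_lt ht)] at this
    rw [this]
    rfl
  · congr 1
    have hz : ∀ s : ℝ, (s : ℂ) ^ (1 - ((n + 2 : ℕ) : ℤ)) = ((s : ℂ) ^ (n + 1))⁻¹ := by
      intro s
      rw [show (1 - ((n + 2 : ℕ) : ℤ)) = -((n + 1 : ℕ) : ℤ) by push_cast; ring, zpow_neg,
        zpow_natCast]
    simp only [hz]
    generalize (∫ s in Ioi r₀, (((s : ℂ) ^ (n + 1))⁻¹ : ℂ) * f s) = Z
    rw [show 2 * (n + 2) - 2 = 2 * n + 2 by omega, Nat.factorial_succ]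
    have h1 : (n.factorial : ℂ) ≠ 0 := by exact_mod_cast Nat.factorial_ne_zero n
    have h2 : (n : ℂ) + 1 ≠ 0 := by exact_mod_cast Nat.succ_ne_zero n
    push_cast
    field_simp
    ring
end

section
/- (Vanishing residue of the particular solution.) Fix r_0 > 0, an integer k ≥ 0, and r > r_0. Let f : (r_0, ∞) → ℂ be measurable with √s·f(s) ∈ L¹(r_0, ∞); for k = 0 assume additionally that s·(1 + |ln s|)·f(s) ∈ L¹(r_0, ∞). Then lim_{τ→0+} τ·[K_k(√τ·r)·∫_{r_0}^r f(s)·I_k(√τ·s)·s ds + I_k(√τ·r)·∫_r^∞ f(s)·K_k(√τ·s)·s ds] = 0. -/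
open Complex Set Filter MeasureTheory

lemma abs_besselI_le (k : ℕ) (x : ℝ) (hx : 0 ≤ x) :
    |besselI k x| ≤ x ^ k * Real.exp (x ^ 2) := by
  have h : HasSum (fun m : ℕ => x ^ k * ((x ^ 2) ^ m / (Nat.factorial m : ℝ)))
      (x ^ k * Real.exp (x ^ 2)) := by
    apply HasSum.mul_left
    rw [Real.exp_eq_exp_ℝ]
    exact NormedSpace.expSeries_div_hasSum_exp (x ^ 2)
  rw [← Real.norm_eq_abs]
  unfold besselI
  refine tsum_of_norm_bounded h (fun m => ?_)
  have h1 : (1 : ℝ) ≤ (Nat.factorial (m + k) : ℝ) := by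
    exact_mod_cast Nat.factorial_pos _
  have h0 : (0 : ℝ) < (Nat.factorial m : ℝ) := by
    exact_mod_cast Nat.factorial_pos _
  rw [Real.norm_of_nonneg (by positivity), ← mul_div_assoc]
  have e : x ^ k * (x ^ 2) ^ m = x ^ (2 * m + k) := by
    rw [← pow_mul, ← pow_add, add_comm]
  rw [e]
  apply div_le_div₀ (by positivity) _ h0 (le_mul_of_one_le_right h0.le h1)
  exact pow_le_pow_left₀ (by positivity) (by linarith) _

lemma abs_besselK_le (k : ℕ) (x : ℝ) (hx : 0 < x) :
    |besselK k x| ≤ ((Nat.factorial (k + 1) : ℝ) * 2 ^ (k + 1)) / x ^ (k + 1) := by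
  set C : ℝ := ((Nat.factorial (k + 1) : ℝ) * 2 ^ (k + 1)) / x ^ (k + 1) with hC
  have hf : (0 : ℝ) < (Nat.factorial (k + 1) : ℝ) := by
    exact_mod_cast Nat.factorial_pos _
  have hint : IntegrableOn (fun t : ℝ => C * Real.exp (-t)) (Ioi 0) :=
    (integrableOn_exp_neg_Ioi 0).const_mul C
  have hb := norm_integral_le_of_norm_le (μ := volume.restrict (Ioi (0 : ℝ)))
    (f := fun t : ℝ => Real.exp (-x * Real.cosh t) * Real.cosh (k * t)) hint ?_
  · rw [integral_const_mul, integral_exp_neg_Ioi_zero, mul_one] at hb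
    exact hb
  · refine (ae_restrict_iff' measurableSet_Ioi).2 (Eventually.of_forall fun t ht => ?_)
    have ht : 0 < t := ht
    have hc : 0 < Real.cosh (k * t) := Real.cosh_pos _
    rw [Real.norm_of_nonneg (by positivity)]
    have h1 : Real.cosh (k * t) ≤ Real.exp t ^ k := by
      rw [← Real.exp_nat_mul, Real.cosh_eq]
      have : Real.exp (-(k * t)) ≤ Real.exp (k * t) :=
        Real.exp_le_exp.2 (by have : 0 ≤ k * t := by positivity
                              linarith)
      linarith
    have h2 : Real.exp t / 2 ≤ Real.cosh t := by
      rw [Real.cosh_eq]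
      have := Real.exp_pos (-t)
      linarith
    have h3 : Real.exp (-x * Real.cosh t) ≤ Real.exp (-(x * (Real.exp t / 2))) := by
      apply Real.exp_le_exp.2
      nlinarith
    have h4 := Real.pow_div_factorial_le_exp (x * (Real.exp t / 2)) (by positivity) (k + 1)
    have h5 : Real.exp (-(x * (Real.exp t / 2))) ≤
        (Nat.factorial (k + 1) : ℝ) / (x * (Real.exp t / 2)) ^ (k + 1) := by
      have h6 := inv_anti₀ (by positivity) h4
      rwa [inv_div, ← Real.exp_neg] at h6
    calc _ ≤ (Nat.factorial (k + 1) : ℝ) / (x * (Real.exp t / 2)) ^ (k + 1) * Real.exp t ^ k :=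
          mul_le_mul (h3.trans h5) h1 hc.le (by positivity)
      _ = C * Real.exp (-t) := by
          rw [hC, Real.exp_neg, mul_pow, div_pow, pow_succ (Real.exp t)]
          have := Real.exp_pos t
          field_simp

theorem residue_particular_term_zero (r₀ : ℝ) (hr₀ : 0 < r₀) (k : ℕ)
    (r : ℝ) (hr : r₀ < r) (f : ℝ → ℂ)
    (hL1 : IntegrableOn (fun s : ℝ => (Real.sqrt s : ℂ) * f s) (Set.Ioi r₀))
    (hL0 : k = 0 → IntegrableOn
      (fun s : ℝ => ((s * (1 + |Real.log s|) : ℝ) : ℂ) * f s) (Set.Ioi r₀)) :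
    Tendsto (fun τ : ℝ => (τ : ℂ) *
        ((besselK k (Real.sqrt τ * r) : ℂ) *
            (∫ s in r₀..r, f s * (besselI k (Real.sqrt τ * s) : ℂ) * (s : ℂ))
          + (besselI k (Real.sqrt τ * r) : ℂ) *
            (∫ s in Set.Ioi r, f s * (besselK k (Real.sqrt τ * s) : ℂ) * (s : ℂ))))
      (nhdsWithin 0 (Set.Ioi 0)) (nhds 0) := by
  have hrp : 0 < r := hr₀.trans hr
  set g : ℝ → ℝ := fun s => (Real.sqrt r₀)⁻¹ * ‖(Real.sqrt s : ℂ) * f s‖ with hg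
  have hgi : IntegrableOn g (Ioi r₀) := hL1.norm.const_mul _
  have hsq : 0 < Real.sqrt r₀ := Real.sqrt_pos.2 hr₀
  have hg0 : ∀ s, 0 ≤ g s := fun s => by simp only [hg]; positivity
  have hfg : ∀ s, r₀ < s → ‖f s‖ ≤ g s := by
    intro s hs
    simp only [hg]
    rw [norm_mul, Complex.norm_real, Real.norm_of_nonneg (Real.sqrt_nonneg s), ← mul_assoc]
    apply le_mul_of_one_le_left (norm_nonneg _)
    rw [inv_mul_eq_div, one_le_div hsq]
    exact Real.sqrt_le_sqrt hs.le
  set N : ℝ := ∫ s in Ioi r₀, g s with hN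
  have hN0 : 0 ≤ N := integral_nonneg hg0
  set C : ℝ := (Nat.factorial (k + 1) : ℝ) * 2 ^ (k + 1) with hC
  have hC0 : 0 < C := by
    have : (0 : ℝ) < (Nat.factorial (k + 1) : ℝ) := by exact_mod_cast Nat.factorial_pos _
    positivity
  set E : ℝ := Real.exp (r ^ 2) with hE
  have hE0 : 0 < E := Real.exp_pos _
  have hlim : Tendsto (fun τ : ℝ => Real.sqrt τ * (2 * C * E * N))
      (nhdsWithin 0 (Set.Ioi 0)) (nhds 0) := by
    have : Continuous (fun τ : ℝ => Real.sqrt τ * (2 * C * E * N)) := by fun_prop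
    have h := this.tendsto 0
    simp only [Real.sqrt_zero, zero_mul] at h
    exact h.mono_left nhdsWithin_le_nhds
  refine squeeze_zero_norm' ?_ hlim
  filter_upwards [Ioo_mem_nhdsGT (zero_lt_one : (0 : ℝ) < 1)] with τ hτ
  set a := Real.sqrt τ with ha
  have ha0 : 0 < a := Real.sqrt_pos.2 hτ.1
  have ha1 : a ≤ 1 := Real.sqrt_le_one.2 hτ.2.le
  have hτa : τ = a ^ 2 := (Real.sq_sqrt hτ.1.le).symm
  have hIb : ∀ s, 0 < s → s ≤ r → |besselI k (a * s)| ≤ (a * r) ^ k * E := by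
    intro s hs hsr
    have hle : a * s ≤ a * r := by gcongr
    have hle2 : a * s ≤ r := by nlinarith
    refine (abs_besselI_le k _ (by positivity)).trans ?_
    rw [hE]
    gcongr
  have hKr : |besselK k (a * r)| ≤ C / (a * r) ^ (k + 1) := abs_besselK_le k _ (by positivity)
  have hA : ‖∫ s in r₀..r, f s * (besselI k (a * s) : ℂ) * (s : ℂ)‖
      ≤ (a * r) ^ k * E * r * N := by
    rw [intervalIntegral.integral_of_le hr.le]
    have hsub : Ioc r₀ r ⊆ Ioi r₀ := Ioc_subset_Ioi_self
    have h1 : ‖∫ s in Ioc r₀ r, f s * (besselI k (a * s) : ℂ) * (s : ℂ)‖ ≤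
        ∫ s in Ioc r₀ r, (a * r) ^ k * E * r * g s := by
      refine norm_integral_le_of_norm_le ((hgi.mono_set hsub).const_mul _) ?_
      refine (ae_restrict_iff' measurableSet_Ioc).2 (Eventually.of_forall fun s hs => ?_)
      have hs0 : 0 < s := hr₀.trans hs.1
      rw [norm_mul, norm_mul, Complex.norm_real, Complex.norm_real, Real.norm_eq_abs,
        Real.norm_of_nonneg hs0.le]
      calc _ ≤ g s * ((a * r) ^ k * E) * r := by
            gcongr
            · exact hfg s hs.1
            · exact hIb s hs0 hs.2
            · exact hs.2
        _ = _ := by ring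
    refine h1.trans ?_
    rw [integral_const_mul]
    gcongr
    exact setIntegral_mono_set hgi (Eventually.of_forall hg0) hsub.eventuallyLE
  have hB : ‖∫ s in Ioi r, f s * (besselK k (a * s) : ℂ) * (s : ℂ)‖
      ≤ C / (a * (a * r) ^ k) * N := by
    have hsub : Ioi r ⊆ Ioi r₀ := Ioi_subset_Ioi hr.le
    have h1 : ‖∫ s in Ioi r, f s * (besselK k (a * s) : ℂ) * (s : ℂ)‖ ≤
        ∫ s in Ioi r, C / (a * (a * r) ^ k) * g s := by
      refine norm_integral_le_of_norm_le ((hgi.mono_set hsub).const_mul _) ?_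
      refine (ae_restrict_iff' measurableSet_Ioi).2 (Eventually.of_forall fun s hs => ?_)
      have hs : r < s := hs
      have hs0 : 0 < s := hrp.trans hs
      rw [norm_mul, norm_mul, Complex.norm_real, Complex.norm_real, Real.norm_eq_abs,
        Real.norm_of_nonneg hs0.le]
      calc _ ≤ g s * (C / (a * s) ^ (k + 1)) * s := by
            gcongr
            · exact hfg s (hr.trans hs)
            · exact abs_besselK_le k _ (by positivity)
        _ = C / (a * (a * s) ^ k) * g s := by
            rw [pow_succ]; field_simp
        _ ≤ _ := by
            have := hg0 s
            gcongr
    refine h1.trans ?_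
    rw [integral_const_mul]
    gcongr
    exact setIntegral_mono_set hgi (Eventually.of_forall hg0) hsub.eventuallyLE
  rw [norm_mul, Complex.norm_real, Real.norm_of_nonneg hτ.1.le]
  calc _ ≤ τ * (C / (a * r) ^ (k + 1) * ((a * r) ^ k * E * r * N)
          + (a * r) ^ k * E * (C / (a * (a * r) ^ k) * N)) := by
        have := hτ.1
        refine mul_le_mul_of_nonneg_left ((norm_add_le _ _).trans ?_) this.le
        rw [norm_mul, norm_mul, Complex.norm_real, Complex.norm_real, Real.norm_eq_abs,
          Real.norm_eq_abs]
        have hIr := hIb r hrp le_rfl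
        gcongr
    _ = a * (2 * C * E * N) := by
        rw [hτa, pow_succ (a * r)]
        field_simp
        ring
end
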